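/- Fix p ≥ 2n−1 and set Λ_p = sup{λ_{1,p}(γ) : γ ∈ R_g}. Let α ∈ R_g^* with λ_{1,p}(α) = Λ_p. Then α is differentiable at every t ∈ [0,1), and |α'(t)|_g = L_g(α) for every t ∈ [0,1). -/

import Mathlib

open Set MeasureTheory Filter Topology

noncomputable section

/-- The closed quarter plane `P`. -/
def Pset : Set (ℝ × ℝ) := {z | 0 ≤ z.1 ∧ 0 ≤ z.2}

/-- The interior `P°` of the quarter plane. -/
def Pint : Set (ℝ × ℝ) := {z | 0 < z.1 ∧ 0 < z.2}

/-- The boundary `∂P` of the quarter plane. -/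
def Pbdry : Set (ℝ × ℝ) := {z | (0 ≤ z.1 ∧ 0 ≤ z.2) ∧ (z.1 = 0 ∨ z.2 = 0)}

/-- `F(x,y) = c_n x^(n-1) y^(n-1)`. -/
def Fvol (n : ℕ) (cn : ℝ) (z : ℝ × ℝ) : ℝ := cn * z.1 ^ (n - 1) * z.2 ^ (n - 1)

/-- Euclidean speed of a curve at `t`, computed with derivatives within `s`. -/
def gSpeedOn (s : Set ℝ) (α : ℝ → ℝ × ℝ) (t : ℝ) : ℝ :=
  Real.sqrt ((derivWithin (fun u => (α u).1) s t) ^ 2 + (derivWithin (fun u => (α u).2) s t) ^ 2)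

/-- Euclidean speed of a curve defined on `[0,1]`. -/
def gSpeed (α : ℝ → ℝ × ℝ) : ℝ → ℝ := gSpeedOn (Icc 0 1) α

/-- Euclidean length `L_g` of a curve on `[0,1]`. -/
def Lg (α : ℝ → ℝ × ℝ) : ℝ := ∫ t in (0:ℝ)..1, gSpeed α t

/-- The `h`-speed `|γ'|_h = F(γ) |γ'|_g`, with derivatives within `s`. -/
def hSpeedOn (n : ℕ) (cn : ℝ) (s : Set ℝ) (α : ℝ → ℝ × ℝ) (t : ℝ) : ℝ :=
  Fvol n cn (α t) * gSpeedOn s α t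

/-- The `h`-speed for curves defined on `[0,1)`. -/
def hSpeed (n : ℕ) (cn : ℝ) (α : ℝ → ℝ × ℝ) : ℝ → ℝ := hSpeedOn n cn (Ico 0 1) α

/-- The `h`-length `L_h` of a curve on `[0,1)`. -/
def Lh (n : ℕ) (cn : ℝ) (α : ℝ → ℝ × ℝ) : ℝ := ∫ t in (0:ℝ)..1, hSpeed n cn α t

/-- Numerator integrand of the `g`-Rayleigh quotient:
`|w'(t)|^p F(α t) |α'(t)|_g^(1-p)`. -/
def numG (n : ℕ) (cn p : ℝ) (s : Set ℝ) (α : ℝ → ℝ × ℝ) (w : ℝ → ℝ) (t : ℝ) : ℝ :=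
  |derivWithin w (Icc 0 1) t| ^ p * Fvol n cn (α t) * gSpeedOn s α t ^ (1 - p)

/-- Denominator integrand of the `g`-Rayleigh quotient:
`|w(t)|^p F(α t) |α'(t)|_g`. -/
def denG (n : ℕ) (cn p : ℝ) (s : Set ℝ) (α : ℝ → ℝ × ℝ) (w : ℝ → ℝ) (t : ℝ) : ℝ :=
  |w t| ^ p * Fvol n cn (α t) * gSpeedOn s α t

/-- First Dirichlet eigenvalue of the `p`-Laplacian along a curve, `g`-form:
infimum of the Rayleigh quotient over Lipschitz test functions on `[0,1]`
vanishing at `0` (with admissible, i.e. integrable with positive denominator,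
Rayleigh quotients). -/
def lambdaGOn (n : ℕ) (cn p : ℝ) (s : Set ℝ) (α : ℝ → ℝ × ℝ) : ℝ :=
  sInf {q | ∃ w : ℝ → ℝ, (∃ K, LipschitzOnWith K w (Icc 0 1)) ∧ w 0 = 0 ∧
    IntervalIntegrable (numG n cn p s α w) volume 0 1 ∧
    IntervalIntegrable (denG n cn p s α w) volume 0 1 ∧
    (0 < ∫ t in (0:ℝ)..1, denG n cn p s α w t) ∧
    q = (∫ t in (0:ℝ)..1, numG n cn p s α w t) / (∫ t in (0:ℝ)..1, denG n cn p s α w t)}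

/-- `λ_{1,p}` in the `g`-form for curves on `[0,1]`. -/
def lambdaG (n : ℕ) (cn p : ℝ) (α : ℝ → ℝ × ℝ) : ℝ := lambdaGOn n cn p (Icc 0 1) α

/-- Numerator integrand of the `h`-Rayleigh quotient on `[c,d]`:
`|w'(t)|^p F(γ t)^p |γ'(t)|_h^(1-p)`. -/
def numH (n : ℕ) (cn p c d : ℝ) (s : Set ℝ) (γ : ℝ → ℝ × ℝ) (w : ℝ → ℝ) (t : ℝ) : ℝ :=
  |derivWithin w (Icc c d) t| ^ p * Fvol n cn (γ t) ^ p * hSpeedOn n cn s γ t ^ (1 - p)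

/-- Denominator integrand of the `h`-Rayleigh quotient: `|w(t)|^p |γ'(t)|_h`. -/
def denH (n : ℕ) (cn p : ℝ) (s : Set ℝ) (γ : ℝ → ℝ × ℝ) (w : ℝ → ℝ) (t : ℝ) : ℝ :=
  |w t| ^ p * hSpeedOn n cn s γ t

/-- `λ_{1,p}` in the `h`-form for a curve on `[c,d)`, with test functions
Lipschitz on `[c,d]` vanishing at `c`. -/
def lambdaHOn (n : ℕ) (cn p c d : ℝ) (s : Set ℝ) (γ : ℝ → ℝ × ℝ) : ℝ :=
  sInf {q | ∃ w : ℝ → ℝ, (∃ K, LipschitzOnWith K w (Icc c d)) ∧ w c = 0 ∧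
    IntervalIntegrable (numH n cn p c d s γ w) volume c d ∧
    IntervalIntegrable (denH n cn p s γ w) volume c d ∧
    (0 < ∫ t in c..d, denH n cn p s γ w t) ∧
    q = (∫ t in c..d, numH n cn p c d s γ w t) / (∫ t in c..d, denH n cn p s γ w t)}

/-- `λ_{1,p}` in the `h`-form for curves on `[0,1)`. -/
def lambdaH (n : ℕ) (cn p : ℝ) (γ : ℝ → ℝ × ℝ) : ℝ :=
  lambdaHOn n cn p 0 1 (Ico 0 1) γ

/-- The class `𝒞` of `C¹` curves from `(x₀,y₀)` to the boundary, with constant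
speed, interior image on `[0,1)`, endpoint away from the origin, and meeting the
boundary orthogonally. -/
def MemC (x0 y0 : ℝ) (α : ℝ → ℝ × ℝ) : Prop :=
  ContDiffOn ℝ 1 α (Icc 0 1) ∧
  α 0 = (x0, y0) ∧
  (∀ t ∈ Ico (0:ℝ) 1, α t ∈ Pint) ∧
  α 1 ∈ Pbdry ∧ α 1 ≠ ((0 : ℝ), (0 : ℝ)) ∧
  (∀ t ∈ Icc (0:ℝ) 1, gSpeed α t = Lg α) ∧
  ((α 1).1 = 0 → derivWithin (fun u => (α u).2) (Icc 0 1) 1 = 0) ∧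
  ((α 1).2 = 0 → derivWithin (fun u => (α u).1) (Icc 0 1) 1 = 0)

/-- The Simons cone curve `σ(t) = (1-t)·(R,R)`. -/
def simonsCurve (R : ℝ) : ℝ → ℝ × ℝ := fun t => ((1 - t) * R, (1 - t) * R)

/-- The class `R_h`: locally Lipschitz curves on `[0,1)` with image in `P°`,
starting at `(x₀,y₀)`, with essentially bounded `h`-speed, reaching the collapsed
boundary point as `t → 1` (i.e. `x(γ t)·y(γ t) → 0`). -/
def MemRh (n : ℕ) (cn x0 y0 : ℝ) (γ : ℝ → ℝ × ℝ) : Prop :=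
  γ 0 = (x0, y0) ∧
  (∀ t ∈ Ico (0:ℝ) 1, γ t ∈ Pint) ∧
  (∀ a ∈ Ico (0:ℝ) 1, ∃ K, LipschitzOnWith K γ (Icc 0 a)) ∧
  (∃ M : ℝ, ∀ᵐ t ∂(volume : Measure ℝ), t ∈ Ico (0:ℝ) 1 → hSpeed n cn γ t ≤ M) ∧
  Tendsto (fun t => (γ t).1 * (γ t).2) (𝓝[<] (1:ℝ)) (𝓝 0)

/-- The class `R_h^+`: continuous curves on `[0,1]` into `P` ending on `∂P`
whose restriction to `[0,1)` belongs to `R_h`. -/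
def MemRhPlus (n : ℕ) (cn x0 y0 : ℝ) (α : ℝ → ℝ × ℝ) : Prop :=
  ContinuousOn α (Icc 0 1) ∧ (∀ t ∈ Icc (0:ℝ) 1, α t ∈ Pset) ∧ α 1 ∈ Pbdry ∧
  MemRh n cn x0 y0 α

/-- The class `R_g`: Lipschitz curves on `[0,1]` from `(x₀,y₀)` to `∂P` with
interior image on `[0,1)`. -/
def MemRg (x0 y0 : ℝ) (α : ℝ → ℝ × ℝ) : Prop :=
  (∃ K, LipschitzOnWith K α (Icc 0 1)) ∧ α 0 = (x0, y0) ∧ α 1 ∈ Pbdry ∧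
  ∀ t ∈ Ico (0:ℝ) 1, α t ∈ Pint

/-- The coordinate `u(x,y) = (x² - y²)/2`. -/
def ucoord (z : ℝ × ℝ) : ℝ := (z.1 ^ 2 - z.2 ^ 2) / 2

/-- The coordinate `v(x,y) = xy`. -/
def vcoord (z : ℝ × ℝ) : ℝ := z.1 * z.2

/-- The coordinate `r = √(u² + v²)`. -/
def rcoord (z : ℝ × ℝ) : ℝ := Real.sqrt (ucoord z ^ 2 + vcoord z ^ 2)

/-- The class `R_g^*`: simple curves in `R_g` with a.e. constant speed,
`u(α(1)) > 0`, and `v(α(t)) ≥ c(1-t)` for some `c > 0`. -/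
def MemRgStar (x0 y0 : ℝ) (α : ℝ → ℝ × ℝ) : Prop :=
  MemRg x0 y0 α ∧ InjOn α (Icc 0 1) ∧
  (∀ᵐ t ∂(volume : Measure ℝ), t ∈ Icc (0:ℝ) 1 → gSpeed α t = Lg α) ∧
  0 < ucoord (α 1) ∧
  ∃ c > (0:ℝ), ∀ t ∈ Icc (0:ℝ) 1, c * (1 - t) ≤ vcoord (α t)

/-- Nonnegative bounded measurable functions, used as slopes of monotone test functions. -/
def IsSlope (f : ℝ → ℝ) : Prop := Measurable f ∧ (∀ t, 0 ≤ f t) ∧ ∃ K, ∀ t, f t ≤ K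

/-- The primitive of `f` vanishing at `0`. -/
def prim (f : ℝ → ℝ) (t : ℝ) : ℝ := ∫ s in (0:ℝ)..t, f s

lemma IsSlope.intervalIntegrable {f : ℝ → ℝ} (hf : IsSlope f) (a b : ℝ) :
    IntervalIntegrable f volume a b := by
  obtain ⟨hm, h0, K, hK⟩ := hf
  refine (intervalIntegrable_const (c := K)).mono_fun hm.aestronglyMeasurable ?_
  refine Eventually.of_forall fun t => ?_
  simp only [Real.norm_eq_abs]
  rw [abs_of_nonneg (h0 t)]
  exact (hK t).trans (le_abs_self K)

lemma IsSlope.prim_nonneg {f : ℝ → ℝ} (hf : IsSlope f) {t : ℝ} (ht : 0 ≤ t) : 0 ≤ prim f t :=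
  intervalIntegral.integral_nonneg ht fun s _ => hf.2.1 s

lemma IsSlope.prim_mono {f : ℝ → ℝ} (hf : IsSlope f) {s t : ℝ} (hst : s ≤ t) :
    prim f s ≤ prim f t := by
  have h := intervalIntegral.integral_add_adjacent_intervals
    (hf.intervalIntegrable 0 s) (hf.intervalIntegrable s t)
  have h2 : 0 ≤ ∫ x in s..t, f x := intervalIntegral.integral_nonneg hst fun s _ => hf.2.1 s
  unfold prim
  linarith

lemma IsSlope.exists_lipschitz {f : ℝ → ℝ} (hf : IsSlope f) :
    ∃ K, LipschitzWith K (prim f) := by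
  obtain ⟨K, hK⟩ := hf.2.2
  refine ⟨K.toNNReal, LipschitzWith.of_dist_le_mul fun s t => ?_⟩
  rw [Real.dist_eq, Real.dist_eq]
  unfold prim
  rw [intervalIntegral.integral_interval_sub_left (hf.intervalIntegrable _ _)
    (hf.intervalIntegrable _ _)]
  rw [← Real.norm_eq_abs]
  refine intervalIntegral.norm_integral_le_of_norm_le_const fun x _ => ?_
  rw [Real.norm_eq_abs, abs_of_nonneg (hf.2.1 x)]
  exact (hK x).trans (Real.le_coe_toNNReal K)

lemma IsSlope.continuous_prim {f : ℝ → ℝ} (hf : IsSlope f) : Continuous (prim f) :=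
  hf.exists_lipschitz.choose_spec.continuous

lemma IsSlope.rpow {f : ℝ → ℝ} (hf : IsSlope f) {p : ℝ} (hp : 0 ≤ p) :
    IsSlope fun t => f t ^ p := by
  obtain ⟨hm, h0, K, hK⟩ := hf
  exact ⟨hm.pow_const p, fun t => Real.rpow_nonneg (h0 t) p, K ^ p,
    fun t => Real.rpow_le_rpow (h0 t) (hK t) hp⟩

lemma IsSlope.integrable_rpow_mul {f G : ℝ → ℝ} (hf : IsSlope f) {p : ℝ} (hp : 0 ≤ p)
    {a b : ℝ} (hG : ContinuousOn G (uIcc a b)) :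
    IntervalIntegrable (fun t => f t ^ p * G t) volume a b :=
  ((hf.rpow hp).intervalIntegrable a b).mul_continuousOn hG

lemma IsSlope.integrable_prim_rpow_mul {f G : ℝ → ℝ} (hf : IsSlope f) {p : ℝ} (hp : 0 ≤ p)
    {a b : ℝ} (hG : ContinuousOn G (uIcc a b)) :
    IntervalIntegrable (fun t => prim f t ^ p * G t) volume a b :=
  ((hf.continuous_prim.continuousOn.rpow_const fun _ _ => Or.inr hp).mul hG).intervalIntegrable

/-- The hypotheses on a weight `G` on `[0,1]` which may degenerate at `1` only, in a way
controlled by an integrable function `H`. -/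
structure WeightData (p c : ℝ) (G H : ℝ → ℝ) : Prop where
  one_lt : 1 < p
  c_pos : 0 < c
  cont : ContinuousOn G (Icc 0 1)
  pos : ∀ t ∈ Ico (0:ℝ) 1, 0 < G t
  nonneg : ∀ t ∈ Icc (0:ℝ) 1, 0 ≤ G t
  H_pos : ∀ t ∈ Ioo (0:ℝ) 1, 0 < H t
  H_int : IntervalIntegrable H volume 0 1
  lower : ∀ t ∈ Ioo (0:ℝ) 1, c ≤ G t * H t ^ (p - 1)

lemma WeightData.le_young {p c : ℝ} {G H : ℝ → ℝ} (h : WeightData p c G H) {K y t : ℝ}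
    (hK : 0 < K) (hy : 0 ≤ y) (ht : t ∈ Ioo (0:ℝ) 1) :
    y ≤ H t * K⁻¹ + K ^ (p - 1) / c * (y ^ p * G t) := by
  have hH := h.H_pos t ht
  have hp := h.one_lt
  have hc := h.c_pos
  have hG : 0 ≤ G t := h.nonneg t ⟨ht.1.le, ht.2.le⟩
  have hA : 0 ≤ H t * K⁻¹ := by positivity
  have hB : 0 ≤ K ^ (p - 1) / c * (y ^ p * G t) := by positivity
  by_cases hle : y ≤ H t * K⁻¹
  · linarith
  push Not at hle
  have hy0 : 0 < y := hA.trans_lt hle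
  have h1 : H t ≤ y * K := by
    rw [← div_eq_mul_inv, div_lt_iff₀ hK] at hle; exact hle.le
  have h2 : H t ^ (p - 1) ≤ y ^ (p - 1) * K ^ (p - 1) := by
    rw [← Real.mul_rpow hy hK.le]
    exact Real.rpow_le_rpow hH.le h1 (by linarith)
  have h3 : c ≤ G t * (y ^ (p - 1) * K ^ (p - 1)) :=
    (h.lower t ht).trans (mul_le_mul_of_nonneg_left h2 hG)
  have h4 : y ^ p = y * y ^ (p - 1) := by
    rw [← Real.rpow_one_add' hy (by linarith)]; congr 1; ring
  have h5 : K ^ (p - 1) / c * (y ^ p * G t) = y * (G t * (y ^ (p - 1) * K ^ (p - 1)) / c) := by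
    rw [h4]; ring
  have h6 : 1 ≤ G t * (y ^ (p - 1) * K ^ (p - 1)) / c := by
    rw [le_div_iff₀ hc]; linarith
  nlinarith

lemma ae_of_Ioo {P : ℝ → Prop} (h : ∀ t ∈ Ioo (0:ℝ) 1, P t) :
    ∀ᵐ t ∂(volume.restrict (Icc (0:ℝ) 1)), P t := by
  rw [← Measure.restrict_congr_set (Ioo_ae_eq_Icc (α := ℝ) (μ := volume)),
    ae_restrict_iff' measurableSet_Ioo]
  exact Eventually.of_forall h

lemma WeightData.prim_one_le {p c : ℝ} {G H : ℝ → ℝ} (h : WeightData p c G H) {f : ℝ → ℝ}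
    (hf : IsSlope f) {K : ℝ} (hK : 0 < K) :
    prim f 1 ≤ (∫ t in (0:ℝ)..1, H t) * K⁻¹
      + K ^ (p - 1) / c * ∫ t in (0:ℝ)..1, f t ^ p * G t := by
  have hp : 0 ≤ p := by linarith [h.one_lt]
  have hfG := hf.integrable_rpow_mul hp (a := 0) (b := 1) (G := G)
    (by simpa using h.cont)
  rw [← intervalIntegral.integral_mul_const, ← intervalIntegral.integral_const_mul,
    ← intervalIntegral.integral_add (h.H_int.mul_const _) (hfG.const_mul _)]
  refine intervalIntegral.integral_mono_ae_restrict zero_le_one (hf.intervalIntegrable _ _)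
    ((h.H_int.mul_const _).add (hfG.const_mul _)) ?_
  exact ae_of_Ioo fun t ht => h.le_young hK (hf.2.1 t) ht

lemma WeightData.integral_nonneg {p c : ℝ} {G H : ℝ → ℝ} (h : WeightData p c G H) {f : ℝ → ℝ}
    {a b : ℝ} (ha : 0 ≤ a) (hab : a ≤ b) (hb : b ≤ 1) (hf : ∀ t ∈ Icc a b, 0 ≤ f t) :
    0 ≤ ∫ t in a..b, f t ^ p * G t :=
  intervalIntegral.integral_nonneg hab fun t ht =>
    mul_nonneg (Real.rpow_nonneg (hf t ht) p) (h.nonneg t ⟨ha.trans ht.1, ht.2.trans hb⟩)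

lemma WeightData.exists_sup_bound {p c : ℝ} {G H : ℝ → ℝ} (h : WeightData p c G H) :
    ∃ C > 0, ∀ f, IsSlope f → prim f 1 ^ p ≤ C * ∫ t in (0:ℝ)..1, f t ^ p * G t := by
  have hp := h.one_lt
  have hc := h.c_pos
  have hh : 0 ≤ ∫ t in (0:ℝ)..1, H t := by
    refine intervalIntegral.integral_nonneg_of_ae_restrict zero_le_one ?_
    exact ae_of_Ioo fun t ht => (h.H_pos t ht).le
  set h0 := ∫ t in (0:ℝ)..1, H t
  refine ⟨(h0 + 1 / c) ^ p, by positivity, fun f hf => ?_⟩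
  have hN := h.integral_nonneg le_rfl zero_le_one le_rfl (f := f) fun t _ => hf.2.1 t
  have hle := fun K hK => h.prim_one_le hf (K := K) hK
  set N := ∫ t in (0:ℝ)..1, f t ^ p * G t
  suffices hs : ∀ M, N < M → prim f 1 ^ p ≤ (h0 + 1 / c) ^ p * M by
    refine le_of_forall_gt_imp_ge_of_dense fun y hy => ?_
    have hC : 0 < (h0 + 1 / c) ^ p := by positivity
    have := hs (y / (h0 + 1 / c) ^ p) (by rw [lt_div_iff₀ hC]; linarith)
    rwa [mul_div_cancel₀ _ hC.ne'] at this
  intro M hM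
  have hM0 : 0 < M := hN.trans_lt hM
  have h1 := hle (M ^ (-(1 / p))) (by positivity)
  have h2 : (M ^ (-(1 / p)))⁻¹ = M ^ (1 / p) := by rw [Real.rpow_neg hM0.le, inv_inv]
  have h3 : (M ^ (-(1 / p))) ^ (p - 1) * M = M ^ (1 / p) := by
    rw [← Real.rpow_mul hM0.le]
    nth_rewrite 2 [← Real.rpow_one M]
    rw [← Real.rpow_add hM0]
    congr 1
    field_simp
    ring
  have h4 : (M ^ (-(1 / p))) ^ (p - 1) / c * N ≤ M ^ (1 / p) / c := by
    rw [← h3, mul_div_right_comm]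
    gcongr
  have h5 : prim f 1 ≤ (h0 + 1 / c) * M ^ (1 / p) := by
    rw [h2] at h1
    calc _ ≤ _ := h1
      _ ≤ _ := add_le_add_right h4 _
      _ = _ := by ring
  calc prim f 1 ^ p ≤ ((h0 + 1 / c) * M ^ (1 / p)) ^ p :=
        Real.rpow_le_rpow (hf.prim_nonneg zero_le_one) h5 (by linarith)
    _ = _ := by
        rw [Real.mul_rpow (by positivity) (by positivity), ← Real.rpow_mul hM0.le]
        rw [one_div_mul_cancel (by linarith), Real.rpow_one]

/-- The slope `f` raised by the constant `y` on `[a,b]`. -/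
lemma IsSlope.add_indicator {f : ℝ → ℝ} (hf : IsSlope f) {y : ℝ} (hy : 0 ≤ y) (a b : ℝ) :
    IsSlope fun t => f t + (Ioc a b).indicator (fun _ => y) t := by
  obtain ⟨hm, h0, K, hK⟩ := hf
  refine ⟨hm.add (measurable_const.indicator measurableSet_Ioc), fun t => ?_, K + y, fun t => ?_⟩
  · exact add_nonneg (h0 t) (indicator_nonneg (fun _ _ => hy) t)
  · refine add_le_add (hK t) ?_
    exact indicator_apply_le' (fun _ => le_rfl) fun _ => hy

lemma prim_add_indicator_ge {f : ℝ → ℝ} (hf : IsSlope f) {y : ℝ} (hy : 0 ≤ y) {a b t : ℝ}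
    (ha : 0 ≤ a) (hab : a ≤ b) (ht : b ≤ t) :
    prim f t + y * (b - a) ≤ prim (fun t => f t + (Ioc a b).indicator (fun _ => y) t) t := by
  have hz : IsSlope fun _ : ℝ => (0:ℝ) := ⟨measurable_const, fun _ => le_rfl, 0, fun _ => le_rfl⟩
  have hI : IsSlope ((Ioc a b).indicator fun _ => y) := by
    simpa using hz.add_indicator hy a b
  have h1 : prim (fun t => f t + (Ioc a b).indicator (fun _ => y) t) t
      = prim f t + prim ((Ioc a b).indicator fun _ => y) t :=
    intervalIntegral.integral_add (hf.intervalIntegrable _ _) (hI.intervalIntegrable _ _)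
  have h2 : y * (b - a) = ∫ x in a..b, (Ioc a b).indicator (fun _ => y) x := by
    rw [intervalIntegral.integral_of_le hab, setIntegral_indicator measurableSet_Ioc]
    simp [hab, mul_comm]
  have h3 := intervalIntegral.integral_add_adjacent_intervals
    (hI.intervalIntegrable 0 a) (hI.intervalIntegrable a b)
  have h4 := intervalIntegral.integral_add_adjacent_intervals
    (hI.intervalIntegrable 0 b) (hI.intervalIntegrable b t)
  have h5 := hI.prim_nonneg ha
  have h6 : 0 ≤ ∫ x in b..t, (Ioc a b).indicator (fun _ => y) x :=
    intervalIntegral.integral_nonneg ht fun s _ => hI.2.1 s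
  rw [h1]
  unfold prim at *
  linarith

lemma prim_le_prim_add_indicator {f : ℝ → ℝ} (hf : IsSlope f) {y : ℝ} (hy : 0 ≤ y) {a b t : ℝ}
    (ht : 0 ≤ t) :
    prim f t ≤ prim (fun t => f t + (Ioc a b).indicator (fun _ => y) t) t := by
  refine intervalIntegral.integral_mono_on ht (hf.intervalIntegrable _ _)
    ((hf.add_indicator hy a b).intervalIntegrable _ _) fun s _ => ?_
  exact le_add_of_nonneg_right (indicator_nonneg (fun _ _ => hy) s)

lemma add_rpow_le_two_rpow {x y p : ℝ} (hx : 0 ≤ x) (hy : 0 ≤ y) (hp : 0 ≤ p) :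
    (x + y) ^ p ≤ 2 ^ p * (x ^ p + y ^ p) := by
  have hx' := Real.rpow_nonneg hx p
  have hy' := Real.rpow_nonneg hy p
  rcases le_total x y with h | h
  · calc (x + y) ^ p ≤ (2 * y) ^ p := Real.rpow_le_rpow (by linarith) (by linarith) hp
      _ = 2 ^ p * y ^ p := Real.mul_rpow (by norm_num) hy
      _ ≤ _ := by gcongr; linarith
  · calc (x + y) ^ p ≤ (2 * x) ^ p := Real.rpow_le_rpow (by linarith) (by linarith) hp
      _ = 2 ^ p * x ^ p := Real.mul_rpow (by norm_num) hx
      _ ≤ _ := by gcongr; linarith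

lemma rpow_add_mul_le_add_rpow {x y p : ℝ} (hx : 0 ≤ x) (hy : 0 ≤ y) (hp : 1 < p) :
    x ^ p + p * x ^ (p - 1) * y ≤ (x + y) ^ p := by
  rcases hx.eq_or_lt with rfl | hx
  · rw [Real.zero_rpow (by linarith), Real.zero_rpow (by linarith)]
    simpa using Real.rpow_nonneg hy p
  have h := one_add_mul_self_le_rpow_one_add (s := y / x) (by linarith [div_nonneg hy hx.le]) hp.le
  have h1 : x + y = x * (1 + y / x) := by field_simp
  have h2 : x ^ p = x ^ (p - 1) * x := by
    rw [← Real.rpow_add_one hx.ne']; congr 1; ring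
  rw [h1, Real.mul_rpow hx.le (by positivity)]
  calc x ^ p + p * x ^ (p - 1) * y = x ^ p * (1 + p * (y / x)) := by
        rw [h2]; field_simp
    _ ≤ _ := mul_le_mul_of_nonneg_left h (by positivity)

lemma WeightData.continuousOn_uIcc {p c : ℝ} {G H : ℝ → ℝ} (h : WeightData p c G H) {a b : ℝ}
    (ha : 0 ≤ a) (hab : a ≤ b) (hb : b ≤ 1) : ContinuousOn G (uIcc a b) := by
  rw [uIcc_of_le hab]
  exact h.cont.mono (Icc_subset_Icc ha hb)

lemma WeightData.integral_pos {p c : ℝ} {G H : ℝ → ℝ} (h : WeightData p c G H) {a b : ℝ}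
    (ha : 0 ≤ a) (hab : a < b) (hb : b ≤ 1) : 0 < ∫ t in a..b, G t := by
  refine intervalIntegral.intervalIntegral_pos_of_pos_on
    (h.continuousOn_uIcc ha hab.le hb).intervalIntegrable (fun t ht => ?_) hab
  exact h.pos t ⟨ha.trans ht.1.le, ht.2.trans_le hb⟩

lemma WeightData.den_le {p c : ℝ} {G H : ℝ → ℝ} (h : WeightData p c G H) {f : ℝ → ℝ}
    (hf : IsSlope f) {b : ℝ} (hb0 : 0 ≤ b) (hb : b ≤ 1) :
    ∫ t in (0:ℝ)..b, prim f t ^ p * G t ≤ prim f b ^ p * ∫ t in (0:ℝ)..b, G t := by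
  have hp := h.one_lt
  have hc := h.continuousOn_uIcc le_rfl hb0 hb
  rw [← intervalIntegral.integral_const_mul]
  refine intervalIntegral.integral_mono_on hb0 (hf.integrable_prim_rpow_mul (by linarith) hc)
    (hc.intervalIntegrable.const_mul _) fun t ht => ?_
  have hG := h.nonneg t ⟨ht.1, ht.2.trans hb⟩
  have := Real.rpow_le_rpow (hf.prim_nonneg ht.1) (hf.prim_mono ht.2) (by linarith : 0 ≤ p)
  gcongr

lemma WeightData.le_den {p c : ℝ} {G H : ℝ → ℝ} (h : WeightData p c G H) {f : ℝ → ℝ}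
    (hf : IsSlope f) {b : ℝ} (hb0 : 0 ≤ b) (hb : b ≤ 1) :
    prim f b ^ p * ∫ t in b..1, G t ≤ ∫ t in b..1, prim f t ^ p * G t := by
  have hp := h.one_lt
  have hc := h.continuousOn_uIcc hb0 hb le_rfl
  rw [← intervalIntegral.integral_const_mul]
  refine intervalIntegral.integral_mono_on hb (hc.intervalIntegrable.const_mul _)
    (hf.integrable_prim_rpow_mul (by linarith) hc) fun t ht => ?_
  have hG := h.nonneg t ⟨hb0.trans ht.1, ht.2⟩
  have := Real.rpow_le_rpow (hf.prim_nonneg hb0) (hf.prim_mono ht.1) (by linarith : 0 ≤ p)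
  gcongr

lemma WeightData.split {p c : ℝ} {G H : ℝ → ℝ} (h : WeightData p c G H) {f : ℝ → ℝ}
    (hf : IsSlope f) {b : ℝ} (hb0 : 0 ≤ b) (hb : b ≤ 1) :
    ∫ t in (0:ℝ)..1, prim f t ^ p * G t
      = (∫ t in (0:ℝ)..b, prim f t ^ p * G t) + ∫ t in b..1, prim f t ^ p * G t := by
  have hp := h.one_lt
  rw [intervalIntegral.integral_add_adjacent_intervals
    (hf.integrable_prim_rpow_mul (by linarith) (h.continuousOn_uIcc le_rfl hb0 hb))
    (hf.integrable_prim_rpow_mul (by linarith) (h.continuousOn_uIcc hb0 hb le_rfl))]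

lemma WeightData.tail_ge {p c : ℝ} {G H : ℝ → ℝ} (h : WeightData p c G H) {b : ℝ}
    (hb0 : 0 < b) (hb : b < 1) :
    ∃ k > 0, ∀ f, IsSlope f →
      k * ∫ t in (0:ℝ)..1, prim f t ^ p * G t ≤ ∫ t in b..1, prim f t ^ p * G t := by
  have h0 := h.integral_pos le_rfl hb0 hb.le
  have h1 := h.integral_pos hb0.le hb le_rfl
  refine ⟨(∫ t in b..1, G t) / ((∫ t in (0:ℝ)..b, G t) + ∫ t in b..1, G t), by positivity,
    fun f hf => ?_⟩
  have e1 := h.den_le hf hb0.le hb.le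
  have e2 := h.le_den hf hb0.le hb.le
  rw [h.split hf hb0.le hb.le, div_mul_eq_mul_div, div_le_iff₀ (by positivity)]
  nlinarith

lemma WeightData.den_gain {p c : ℝ} {G H : ℝ → ℝ} (h : WeightData p c G H) {f : ℝ → ℝ}
    (hf : IsSlope f) {a b y m : ℝ} (ha : 0 ≤ a) (hab : a ≤ b) (hb : b ≤ 1) (hy : 0 ≤ y)
    (hm : 0 < m) (hfm : prim f 1 ≤ m) :
    (∫ t in (0:ℝ)..1, prim f t ^ p * G t)
        + p * (y * (b - a)) / m * ∫ t in b..1, prim f t ^ p * G t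
      ≤ ∫ t in (0:ℝ)..1,
        prim (fun t => f t + (Ioc a b).indicator (fun _ => y) t) t ^ p * G t := by
  have hp := h.one_lt
  have hb0 : 0 ≤ b := ha.trans hab
  have hg := hf.add_indicator hy a b
  have c0 := h.continuousOn_uIcc le_rfl hb0 hb
  have c1 := h.continuousOn_uIcc hb0 hb le_rfl
  rw [h.split hf hb0 hb, h.split hg hb0 hb, add_assoc]
  refine add_le_add ?_ ?_
  · refine intervalIntegral.integral_mono_on hb0 (hf.integrable_prim_rpow_mul (by linarith) c0)
      (hg.integrable_prim_rpow_mul (by linarith) c0) fun t ht => ?_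
    have hG := h.nonneg t ⟨ht.1, ht.2.trans hb⟩
    have := Real.rpow_le_rpow (hf.prim_nonneg ht.1)
      (prim_le_prim_add_indicator hf hy (a := a) (b := b) ht.1) (by linarith : 0 ≤ p)
    gcongr
  · have i1 := hf.integrable_prim_rpow_mul (p := p) (by linarith) c1
    rw [← intervalIntegral.integral_const_mul, ← intervalIntegral.integral_add i1 (i1.const_mul _)]
    refine intervalIntegral.integral_mono_on hb (i1.add (i1.const_mul _))
      (hg.integrable_prim_rpow_mul (by linarith) c1) fun t ht => ?_
    have hG := h.nonneg t ⟨hb0.trans ht.1, ht.2⟩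
    have ht0 : 0 ≤ t := hb0.trans ht.1
    have hW := hf.prim_nonneg ht0
    have hyb : 0 ≤ y * (b - a) := mul_nonneg hy (by linarith)
    have e1 := Real.rpow_le_rpow (by positivity) (prim_add_indicator_ge hf hy ha hab ht.1)
      (by linarith : 0 ≤ p)
    have e2 := rpow_add_mul_le_add_rpow hW hyb hp
    have e3 : prim f t ^ p ≤ m * prim f t ^ (p - 1) := by
      have : prim f t ^ p = prim f t * prim f t ^ (p - 1) := by
        rw [← Real.rpow_one_add' hW (by linarith)]; congr 1; ring
      rw [this]
      have hle := (hf.prim_mono ht.2).trans hfm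
      have hn := Real.rpow_nonneg hW (p - 1)
      gcongr
    have e4 : p * (y * (b - a)) / m * prim f t ^ p
        ≤ p * prim f t ^ (p - 1) * (y * (b - a)) := by
      calc _ ≤ p * (y * (b - a)) / m * (m * prim f t ^ (p - 1)) := by gcongr
        _ = _ := by field_simp
    calc prim f t ^ p * G t + p * (y * (b - a)) / m * (prim f t ^ p * G t)
        = (prim f t ^ p + p * (y * (b - a)) / m * prim f t ^ p) * G t := by ring
      _ ≤ _ := mul_le_mul_of_nonneg_right (by linarith) hG

lemma WeightData.num_cost {p c : ℝ} {G H : ℝ → ℝ} (h : WeightData p c G H) {f : ℝ → ℝ}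
    (hf : IsSlope f) {a b y : ℝ} (ha : 0 ≤ a) (hab : a ≤ b) (hb : b ≤ 1) (hy : 0 ≤ y) :
    ∫ t in (0:ℝ)..1, (f t + (Ioc a b).indicator (fun _ => y) t) ^ p * G t
      ≤ (∫ t in (0:ℝ)..1, f t ^ p * G t)
        + 2 ^ p * ((∫ t in a..b, f t ^ p * G t) + y ^ p * ∫ t in a..b, G t) := by
  have hp := h.one_lt
  have hg := hf.add_indicator hy a b
  have c1 := h.continuousOn_uIcc le_rfl zero_le_one le_rfl
  have cI := h.continuousOn_uIcc ha hab hb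
  have i1 := hf.integrable_rpow_mul (p := p) (by linarith) c1
  have iI := hf.integrable_rpow_mul (p := p) (by linarith) cI
  have hsub : Ioc a b ⊆ Ioc 0 1 := Ioc_subset_Ioc ha hb
  have e : 2 ^ p * ((∫ t in a..b, f t ^ p * G t) + y ^ p * ∫ t in a..b, G t)
      = ∫ t in (0:ℝ)..1, (Ioc a b).indicator (fun t => 2 ^ p * (f t ^ p * G t + y ^ p * G t)) t := by
    rw [← intervalIntegral.integral_const_mul, ← intervalIntegral.integral_add iI
      (cI.intervalIntegrable.const_mul _), ← intervalIntegral.integral_const_mul,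
      intervalIntegral.integral_of_le hab, intervalIntegral.integral_of_le zero_le_one,
      setIntegral_indicator measurableSet_Ioc, inter_eq_right.2 hsub]
  have iJ : IntervalIntegrable
      ((Ioc a b).indicator (fun t => 2 ^ p * (f t ^ p * G t + y ^ p * G t))) volume 0 1 := by
    rw [intervalIntegrable_iff_integrableOn_Ioc_of_le zero_le_one]
    have := (iI.add (cI.intervalIntegrable.const_mul (y ^ p))).const_mul (2 ^ p)
    rw [intervalIntegrable_iff_integrableOn_Ioc_of_le hab] at this
    exact IntegrableOn.integrable_indicator (this.restrict) measurableSet_Ioc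
  rw [e, ← intervalIntegral.integral_add i1 iJ]
  refine intervalIntegral.integral_mono_on zero_le_one
    (hg.integrable_rpow_mul (by linarith) c1) (i1.add iJ) fun t ht => ?_
  have hG := h.nonneg t ht
  have hft := hf.2.1 t
  have hfp := Real.rpow_nonneg hft p
  by_cases htI : t ∈ Ioc a b
  · simp only [indicator_of_mem htI]
    have := mul_le_mul_of_nonneg_right
      (add_rpow_le_two_rpow hft hy (by linarith : 0 ≤ p)) hG
    nlinarith [mul_nonneg hfp hG]
  · simp [indicator_of_notMem htI]

/-- If `l` is a lower bound for the Rayleigh quotient, then increasing the numerator on a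
subinterval improves the lower bound. -/
lemma WeightData.exists_gap {p c : ℝ} {G H : ℝ → ℝ} (h : WeightData p c G H) {a b l k : ℝ}
    (ha : 0 ≤ a) (hab : a < b) (hb : b < 1) (hk : 0 < k)
    (hl : ∀ f, IsSlope f → l * ∫ t in (0:ℝ)..1, prim f t ^ p * G t
      ≤ ∫ t in (0:ℝ)..1, f t ^ p * G t) :
    ∃ η > 0, ∀ f, IsSlope f → (l + η) * ∫ t in (0:ℝ)..1, prim f t ^ p * G t
      ≤ (∫ t in (0:ℝ)..1, f t ^ p * G t) + k * ∫ t in a..b, f t ^ p * G t := by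
  have hp := h.one_lt
  have hp0 : 0 < p := by linarith
  have hb0 : 0 < b := ha.trans_lt hab
  obtain ⟨C, hC, hsup⟩ := h.exists_sup_bound
  have hg1 := h.integral_pos le_rfl zero_lt_one le_rfl
  have hgI := h.integral_pos ha hab hb.le
  set g1 := ∫ t in (0:ℝ)..1, G t
  set gI := ∫ t in a..b, G t with hgIdef
  have hτ0 : ∀ f, IsSlope f → 0 ≤ ∫ t in a..b, f t ^ p * G t := fun f hf =>
    h.integral_nonneg ha hab.le hb.le fun t _ => hf.2.1 t
  by_cases hsmall : l < 1 / (C * g1)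
  · refine ⟨1 / (C * g1) - l, by linarith, fun f hf => ?_⟩
    have e1 := h.den_le hf zero_le_one le_rfl
    have e2 := hsup f hf
    have e3 := hτ0 f hf
    have e4 : ∫ t in (0:ℝ)..1, prim f t ^ p * G t
        ≤ C * (∫ t in (0:ℝ)..1, f t ^ p * G t) * g1 :=
      e1.trans (mul_le_mul_of_nonneg_right e2 hg1.le)
    have e5 : 1 / (C * g1) * ∫ t in (0:ℝ)..1, prim f t ^ p * G t
        ≤ ∫ t in (0:ℝ)..1, f t ^ p * G t := by
      rw [div_mul_eq_mul_div, div_le_iff₀ (by positivity)]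
      linarith
    have := mul_nonneg hk.le e3
    rw [add_sub_cancel]
    linarith
  have hl0 : 0 < l := lt_of_lt_of_le (by positivity) (not_lt.1 hsmall)
  obtain ⟨q, hq, htail⟩ := h.tail_ge hb0 hb
  set M := (C * (l + 1)) ^ (1 / p) with hM
  have hMpos : 0 < M := by positivity
  have hba : 0 < b - a := by linarith
  set E := l * p * (b - a) * q / (2 * M * 2 ^ p * gI) with hE
  have hEpos : 0 < E := by positivity
  set ε := E ^ (1 / (p - 1)) with hε
  have hεpos : 0 < ε := by positivity
  have hεp : ε ^ p = ε * E := by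
    have h1 : ε ^ (p - 1) = E := by
      rw [hε, ← Real.rpow_mul hEpos.le, one_div_mul_cancel (by linarith), Real.rpow_one]
    rw [← h1, ← Real.rpow_one_add' hεpos.le (by linarith)]
    congr 1
    ring
  set e0 := 2 ^ p * (ε ^ p * gI) with he0
  have he0pos : 0 < e0 := by positivity
  have he0' : l * (p * ε * (b - a) / M * q) = 2 * e0 := by
    rw [he0, hεp, hE]
    field_simp
  set θ := min 1 (k / 2 ^ p) with hθ
  have hθpos : 0 < θ := by positivity
  have hθ1 : θ ≤ 1 := min_le_left _ _
  have hθk : θ * 2 ^ p ≤ k := by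
    have : θ ≤ k / 2 ^ p := min_le_right _ _
    rwa [le_div_iff₀ (by positivity)] at this
  refine ⟨min 1 (θ * e0), by positivity, fun f hf => ?_⟩
  have hη1 : min 1 (θ * e0) ≤ 1 := min_le_left _ _
  have hη2 : min 1 (θ * e0) ≤ θ * e0 := min_le_right _ _
  set η := min 1 (θ * e0)
  have hτ := hτ0 f hf
  have hlf := hl f hf
  have hsupf := hsup f hf
  have hcost := fun y hy => h.num_cost hf ha hab.le hb.le (y := y) hy
  have hgain := fun y m hy hm hfm => h.den_gain hf ha hab.le hb.le (y := y) (m := m) hy hm hfm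
  have htl := htail f hf
  have hD0 : 0 ≤ ∫ t in (0:ℝ)..1, prim f t ^ p * G t :=
    h.integral_nonneg le_rfl zero_le_one le_rfl fun t ht => hf.prim_nonneg ht.1
  have hly := fun y hy => hl _ (hf.add_indicator (y := y) hy a b)
  set D := ∫ t in (0:ℝ)..1, prim f t ^ p * G t
  set N := ∫ t in (0:ℝ)..1, f t ^ p * G t
  set τ := ∫ t in a..b, f t ^ p * G t
  rw [← hgIdef] at hcost
  have hkτ : 0 ≤ k * τ := by positivity
  rcases hD0.eq_or_lt with hD | hD
  · rw [← hD] at hlf ⊢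
    linarith
  by_cases hbig : (l + 1) * D < N
  · nlinarith
  push Not at hbig
  set s := D ^ (1 / p) with hs
  have hspos : 0 < s := by positivity
  have hsp : s ^ p = D := by
    rw [hs, ← Real.rpow_mul hD.le, one_div_mul_cancel hp0.ne', Real.rpow_one]
  have hfm : prim f 1 ≤ M * s := by
    have h1 : prim f 1 ^ p ≤ (M * s) ^ p := by
      rw [Real.mul_rpow hMpos.le hspos.le, hsp, hM, ← Real.rpow_mul (by positivity),
        one_div_mul_cancel hp0.ne', Real.rpow_one]
      calc _ ≤ _ := hsupf
        _ ≤ C * ((l + 1) * D) := by gcongr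
        _ = _ := by ring
    exact (Real.rpow_le_rpow_iff (hf.prim_nonneg zero_le_one) (by positivity) hp0).1 h1
  have hy : 0 ≤ ε * s := by positivity
  have h1 := hly _ hy
  have h2 := hcost _ hy
  have h3 := hgain _ _ hy (by positivity) hfm
  have h4 : p * (ε * s * (b - a)) / (M * s) = p * ε * (b - a) / M := by
    field_simp
  rw [h4] at h3
  have h5 : (ε * s) ^ p = ε ^ p * D := by rw [Real.mul_rpow hεpos.le hspos.le, hsp]
  rw [h5] at h2
  have h6 : p * ε * (b - a) / M * (q * D) ≤ p * ε * (b - a) / M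
      * ∫ t in b..1, prim f t ^ p * G t := by gcongr
  have h7 := (mul_le_mul_of_nonneg_left (le_trans (add_le_add_right h6 D) h3) hl0.le).trans
    (h1.trans h2)
  have h8 : l * D + 2 * e0 * D ≤ N + 2 ^ p * τ + e0 * D := by
    rw [← he0', he0]
    linarith
  have h9 : θ * 2 ^ p * τ ≤ k * τ := by gcongr
  have h10 : θ * (l * D + e0 * D) ≤ θ * (N + 2 ^ p * τ) := by
    apply mul_le_mul_of_nonneg_left _ hθpos.le; linarith
  have h11 : (1 - θ) * (l * D) ≤ (1 - θ) * N := mul_le_mul_of_nonneg_left hlf (by linarith)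
  have h12 : η * D ≤ θ * e0 * D := by gcongr
  linarith

lemma gSpeed_eq_deriv {γ : ℝ → ℝ × ℝ} {t : ℝ} (ht : t ∈ Ioo (0:ℝ) 1) :
    gSpeed γ t = Real.sqrt (deriv (fun u => (γ u).1) t ^ 2 + deriv (fun u => (γ u).2) t ^ 2) := by
  unfold gSpeed gSpeedOn
  rw [derivWithin_of_mem_nhds (Icc_mem_nhds ht.1 ht.2),
    derivWithin_of_mem_nhds (Icc_mem_nhds ht.1 ht.2)]

lemma lipschitzOn_fst {γ : ℝ → ℝ × ℝ} {s : Set ℝ} (h : ∃ K, LipschitzOnWith K γ s) :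
    ∃ K, LipschitzOnWith K (fun t => (γ t).1) s :=
  ⟨_, LipschitzWith.prod_fst.comp_lipschitzOnWith h.choose_spec⟩

lemma lipschitzOn_snd {γ : ℝ → ℝ × ℝ} {s : Set ℝ} (h : ∃ K, LipschitzOnWith K γ s) :
    ∃ K, LipschitzOnWith K (fun t => (γ t).2) s :=
  ⟨_, LipschitzWith.prod_snd.comp_lipschitzOnWith h.choose_spec⟩

lemma absolutelyContinuous_of_lipschitzOn {f : ℝ → ℝ} (h : ∃ K, LipschitzOnWith K f (Icc 0 1))
    {s t : ℝ} (hs : 0 ≤ s) (hst : s ≤ t) (ht : t ≤ 1) :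
    AbsolutelyContinuousOnInterval f s t := by
  obtain ⟨K, hK⟩ := h
  refine (hK.mono ?_).absolutelyContinuousOnInterval
  rw [uIcc_of_le hst]
  exact Icc_subset_Icc hs ht

/-- A Lipschitz curve of almost everywhere constant speed `L` is `L`-Lipschitz for the Euclidean
distance. -/
lemma chord_sq_le {γ : ℝ → ℝ × ℝ} (hγ : ∃ K, LipschitzOnWith K γ (Icc 0 1)) {L : ℝ} (hL : 0 ≤ L)
    (hspeed : ∀ᵐ t ∂(volume : Measure ℝ), t ∈ Icc (0:ℝ) 1 → gSpeed γ t = L) {s t : ℝ}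
    (hs : 0 ≤ s) (hst : s ≤ t) (ht : t ≤ 1) :
    ((γ t).1 - (γ s).1) ^ 2 + ((γ t).2 - (γ s).2) ^ 2 ≤ (L * (t - s)) ^ 2 := by
  have ax := absolutelyContinuous_of_lipschitzOn (lipschitzOn_fst hγ) hs hst ht
  have ay := absolutelyContinuous_of_lipschitzOn (lipschitzOn_snd hγ) hs hst ht
  have ex := ax.integral_deriv_eq_sub
  have ey := ay.integral_deriv_eq_sub
  set X := (γ t).1 - (γ s).1
  set Y := (γ t).2 - (γ s).2
  set D := Real.sqrt (X ^ 2 + Y ^ 2) with hD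
  have hD2 : D ^ 2 = X ^ 2 + Y ^ 2 := Real.sq_sqrt (by positivity)
  have hD0 : 0 ≤ D := Real.sqrt_nonneg _
  have ix := ax.intervalIntegrable_deriv.const_mul X
  have iy := ay.intervalIntegrable_deriv.const_mul Y
  have e1 : ∫ u in s..t, (X * deriv (fun u => (γ u).1) u + Y * deriv (fun u => (γ u).2) u)
      = D ^ 2 := by
    rw [intervalIntegral.integral_add ix iy, intervalIntegral.integral_const_mul,
      intervalIntegral.integral_const_mul, ex, ey, hD2]
    ring
  have e2 : ∫ u in s..t, (X * deriv (fun u => (γ u).1) u + Y * deriv (fun u => (γ u).2) u)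
      ≤ ∫ _ in s..t, D * L := by
    refine intervalIntegral.integral_mono_ae_restrict hst (ix.add iy)
      intervalIntegrable_const ?_
    rw [← Measure.restrict_congr_set (Ioo_ae_eq_Icc (α := ℝ) (μ := volume)), EventuallyLE,
      ae_restrict_iff' measurableSet_Ioo]
    filter_upwards [hspeed] with u hu hu'
    have hu1 : u ∈ Ioo (0:ℝ) 1 := ⟨hs.trans_lt hu'.1, hu'.2.trans_le ht⟩
    have h1 := hu ⟨hu1.1.le, hu1.2.le⟩
    rw [gSpeed_eq_deriv hu1] at h1
    set x' := deriv (fun u => (γ u).1) u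
    set y' := deriv (fun u => (γ u).2) u
    have h2 : x' ^ 2 + y' ^ 2 = L ^ 2 := by
      rw [← h1, Real.sq_sqrt (by positivity)]
    refine abs_le_of_sq_le_sq' ?_ (by positivity) |>.2
    rw [mul_pow, hD2, ← h2]
    nlinarith [sq_nonneg (X * y' - Y * x')]
  rw [e1, intervalIntegral.integral_const, smul_eq_mul] at e2
  rw [← hD2]
  refine pow_le_pow_left₀ hD0 ?_ 2
  by_contra! hlt
  have : 0 < D := lt_of_le_of_lt (mul_nonneg hL (by linarith)) hlt
  nlinarith

/-- Stewart's theorem, as an estimate of the distance to a point of a segment. -/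
lemma dist_segment_sq_le {x₁ y₁ x₂ y₂ x y s l d : ℝ} (hs0 : 0 ≤ s) (hs1 : s ≤ 1)
    (h₁ : (x - x₁) ^ 2 + (y - y₁) ^ 2 ≤ (s * l) ^ 2)
    (h₂ : (x₂ - x) ^ 2 + (y₂ - y) ^ 2 ≤ ((1 - s) * l) ^ 2)
    (hd : d ≤ (x₂ - x₁) ^ 2 + (y₂ - y₁) ^ 2) :
    (x - (x₁ + s * (x₂ - x₁))) ^ 2 + (y - (y₁ + s * (y₂ - y₁))) ^ 2
      ≤ s * (1 - s) * (l ^ 2 - d) := by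
  have e1 := mul_le_mul_of_nonneg_left h₁ (sub_nonneg.2 hs1)
  have e2 := mul_le_mul_of_nonneg_left h₂ hs0
  have e3 := mul_le_mul_of_nonneg_left hd (mul_nonneg hs0 (sub_nonneg.2 hs1))
  linarith

lemma dyadic_bound {S : ℝ → ℝ} {C δ : ℝ} (hC : 0 ≤ C)
    (hS : ∀ h, 0 < h → h ≤ δ → ∀ s, 1 / 2 ≤ s → s ≤ 1 → |S (s * h) - S h| ≤ C * h)
    {h h' : ℝ} (hh' : 0 < h') (hle : h' ≤ h) (hδ : h ≤ δ) : |S h' - S h| ≤ 2 * C * h := by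
  have key : ∀ k : ℕ, ∀ h, 0 < h → h ≤ δ → ∀ h', h / 2 ^ k ≤ h' → h' ≤ h →
      |S h' - S h| ≤ 2 * C * h := by
    intro k
    induction k with
    | zero =>
      intro h h0 _ h' h1 h2
      have : h' = h := le_antisymm h2 (by simpa using h1)
      rw [this, sub_self, abs_zero]
      positivity
    | succ k ih =>
      intro h h0 hδ h' h1 h2
      by_cases hc : h / 2 ≤ h'
      · have := hS h h0 hδ (h' / h) (by rw [le_div_iff₀ h0]; linarith)
          (by rw [div_le_one h0]; exact h2)
        rw [div_mul_cancel₀ _ h0.ne'] at this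
        nlinarith [mul_nonneg hC h0.le]
      · push Not at hc
        have e1 := ih (h / 2) (by linarith) (by linarith) h'
          (by rw [pow_succ] at h1; rw [div_div, mul_comm]; exact h1) hc.le
        have e2 := hS h h0 hδ (1 / 2) le_rfl (by norm_num)
        rw [one_div_mul_eq_div] at e2
        have := abs_sub_le (S h') (S (h / 2)) (S h)
        linarith
  have h0 : 0 < h := hh'.trans_le hle
  obtain ⟨k, hk⟩ := pow_unbounded_of_one_lt (h / h') (one_lt_two (α := ℝ))
  refine key k h h0 hδ h' ?_ hle
  rw [div_lt_iff₀ hh'] at hk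
  rw [div_le_iff₀ (by positivity)]
  linarith

/-- A function staying quadratically close to all its chords is differentiable. -/
lemma differentiableWithinAt_of_chord_bound {f : ℝ → ℝ} {C T t₀ : ℝ} (hC : 0 ≤ C) (hT : T < 1)
    (hf : ∀ a b, 0 ≤ a → a < b → b ≤ T → ∀ s, 0 ≤ s → s ≤ 1 →
      |f (a + s * (b - a)) - (f a + s * (f b - f a))| ≤ C * (b - a) ^ 2)
    (h₀ : 0 ≤ t₀) (h₁ : t₀ < T) : DifferentiableWithinAt ℝ f (Icc 0 1) t₀ := by
  set S : ℝ → ℝ := fun u => (f (t₀ + u) - f t₀) / u with hSdef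
  have right : ∀ h, 0 < h → h ≤ T - t₀ → ∀ s, 1 / 2 ≤ s → s ≤ 1 →
      |S (s * h) - S h| ≤ 2 * C * h := by
    intro h h0 hδ s hs hs1
    have hs0 : 0 < s := by linarith
    have e := hf t₀ (t₀ + h) h₀ (by linarith) (by linarith) s hs0.le hs1
    have e1 : S (s * h) - S h
        = (f (t₀ + s * (t₀ + h - t₀)) - (f t₀ + s * (f (t₀ + h) - f t₀))) / (s * h) := by
      simp only [hSdef, add_sub_cancel_left]
      field_simp
      ring
    rw [e1, abs_div, abs_of_pos (by positivity : 0 < s * h), div_le_iff₀ (by positivity)]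
    rw [add_sub_cancel_left] at e ⊢
    nlinarith [mul_nonneg hC (sq_nonneg h)]
  have left : ∀ h, 0 < h → h ≤ t₀ → ∀ s, 1 / 2 ≤ s → s ≤ 1 →
      |S (-(s * h)) - S (-h)| ≤ 2 * C * h := by
    intro h h0 hδ s hs hs1
    have hs0 : 0 < s := by linarith
    have e := hf (t₀ - h) t₀ (by linarith) (by linarith) h₁.le (1 - s) (by linarith) (by linarith)
    have e0 : t₀ - h + (1 - s) * (t₀ - (t₀ - h)) = t₀ + -(s * h) := by ring
    have e1 : S (-(s * h)) - S (-h)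
        = -((f (t₀ + -(s * h)) - (f (t₀ - h) + (1 - s) * (f t₀ - f (t₀ - h)))) / (s * h)) := by
      simp only [hSdef, ← sub_eq_add_neg]
      field_simp
      ring
    rw [e1, abs_neg, abs_div, abs_of_pos (by positivity : 0 < s * h), div_le_iff₀ (by positivity)]
    rw [e0, sub_sub_cancel] at e
    nlinarith [mul_nonneg hC (sq_nonneg h)]
  have cross : ∀ h, 0 < h → h ≤ t₀ → h ≤ T - t₀ → |S h - S (-h)| ≤ 8 * C * h := by
    intro h h0 hl hr
    have e := hf (t₀ - h) (t₀ + h) (by linarith) (by linarith) (by linarith) (1 / 2)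
      (by norm_num) (by norm_num)
    have e0 : t₀ - h + 1 / 2 * (t₀ + h - (t₀ - h)) = t₀ := by ring
    have e1 : S h - S (-h)
        = -(2 * (f t₀ - (f (t₀ - h) + 1 / 2 * (f (t₀ + h) - f (t₀ - h)))) / h) := by
      simp only [hSdef, ← sub_eq_add_neg]
      field_simp
      ring
    rw [e0] at e
    rw [e1, abs_neg, abs_div, abs_of_pos h0, div_le_iff₀ h0, abs_mul, abs_two]
    nlinarith
  have rightD : ∀ h h', 0 < h' → h' ≤ h → h ≤ T - t₀ → |S h' - S h| ≤ 4 * C * h := by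
    intro h h' a b c
    have := dyadic_bound (by positivity) right a b c
    linarith
  have leftD : ∀ h h', 0 < h' → h' ≤ h → h ≤ t₀ → |S (-h') - S (-h)| ≤ 4 * C * h := by
    intro h h' a b c
    have := dyadic_bound (S := fun u => S (-u)) (by positivity) left a b c
    linarith
  have pn : ∀ r u v, 0 < u → 0 < v → u ≤ r → v ≤ r → u ≤ T - t₀ → v ≤ t₀ →
      |S u - S (-v)| ≤ 12 * C * r := by
    intro r u v hu hv hur hvr huT hvt
    have hCu : C * u ≤ C * r := by gcongr
    have hCv : C * v ≤ C * r := by gcongr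
    rcases le_total u v with h | h
    · have e1 := cross u hu (h.trans hvt) huT
      have e2 := leftD v u hu h hvt
      have := abs_sub_le (S u) (S (-u)) (S (-v))
      linarith
    · have e1 := cross v hv hvt (h.trans huT)
      have e2 := rightD u v hv h huT
      rw [abs_sub_comm] at e2
      have := abs_sub_le (S u) (S v) (S (-v))
      linarith
  have all : ∀ r u v, u ≠ 0 → v ≠ 0 → |u| ≤ r → |v| ≤ r → -t₀ ≤ u → u ≤ T - t₀ → -t₀ ≤ v →
      v ≤ T - t₀ → |S u - S v| ≤ 12 * C * r := by
    intro r u v hu hv hur hvr hu1 hu2 hv1 hv2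
    have hr : 0 ≤ r := (abs_nonneg u).trans hur
    have hCr : 0 ≤ C * r := by positivity
    rw [abs_le] at hur hvr
    have hCu : C * u ≤ C * r := by gcongr; exact hur.2
    have hCv : C * v ≤ C * r := by gcongr; exact hvr.2
    have hCu' : C * -u ≤ C * r := by gcongr; linarith
    have hCv' : C * -v ≤ C * r := by gcongr; linarith
    rcases hu.lt_or_gt with hu | hu <;> rcases hv.lt_or_gt with hv | hv
    · rcases le_total u v with h | h
      · have := leftD (-u) (-v) (by linarith) (by linarith) (by linarith)
        rw [neg_neg, neg_neg, abs_sub_comm] at this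
        linarith
      · have := leftD (-v) (-u) (by linarith) (by linarith) (by linarith)
        rw [neg_neg, neg_neg] at this
        linarith
    · have := pn r v (-u) hv (by linarith) hvr.2 (by linarith) hv2 (by linarith)
      rwa [neg_neg, abs_sub_comm] at this
    · have := pn r u (-v) hu (by linarith) hur.2 (by linarith) hu2 (by linarith)
      rwa [neg_neg] at this
    · rcases le_total u v with h | h
      · have := rightD v u hu h hv2
        linarith
      · have := rightD u v hv h hu2
        rw [abs_sub_comm] at this
        linarith
  have hNe : (𝓝[Icc (0:ℝ) 1 \ {t₀}] t₀).NeBot := by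
    have := (uniqueDiffOn_Icc (zero_lt_one (α := ℝ)) t₀ ⟨h₀, by linarith⟩).accPt
    rwa [accPt_principal_iff_nhdsWithin] at this
  have hcauchy : Cauchy (map (slope f t₀) (𝓝[Icc (0:ℝ) 1 \ {t₀}] t₀)) := by
    rw [Metric.cauchy_iff]
    refine ⟨hNe.map _, fun ε hε => ?_⟩
    set r := min (T - t₀) (ε / (12 * C + 1) / 2) with hr
    have hr0 : 0 < r := lt_min (by linarith) (by positivity)
    have hrT : r ≤ T - t₀ := min_le_left _ _
    have hrε : 12 * C * r < ε := by
      have h1 : r ≤ ε / (12 * C + 1) / 2 := min_le_right _ _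
      rw [div_div, le_div_iff₀ (by positivity)] at h1
      nlinarith
    refine ⟨slope f t₀ '' ((Icc (0:ℝ) 1 \ {t₀}) ∩ Metric.closedBall t₀ r),
      image_mem_map (inter_mem self_mem_nhdsWithin
        (mem_nhdsWithin_of_mem_nhds (Metric.closedBall_mem_nhds _ hr0))), ?_⟩
    rintro _ ⟨t, ht, rfl⟩ _ ⟨t', ht', rfl⟩
    have hs : ∀ t, slope f t₀ t = S (t - t₀) := by
      intro t
      simp only [hSdef, slope_def_field, add_sub_cancel]
    rw [Real.dist_eq, hs, hs]
    have b1 := ht.2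
    have b2 := ht'.2
    rw [Metric.mem_closedBall, Real.dist_eq] at b1 b2
    have b1' := abs_le.1 b1
    have b2' := abs_le.1 b2
    refine lt_of_le_of_lt (all r _ _ (sub_ne_zero.2 ht.1.2) (sub_ne_zero.2 ht'.1.2) b1 b2
      ?_ ?_ ?_ ?_) hrε
    · linarith [ht.1.1.1]
    · linarith
    · linarith [ht'.1.1.1]
    · linarith
  obtain ⟨l, hl⟩ := (cauchy_map_iff_exists_tendsto (l := 𝓝[Icc (0:ℝ) 1 \ {t₀}] t₀)).1 hcauchy
  exact (hasDerivWithinAt_iff_tendsto_slope.2 hl).differentiableWithinAt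

/-- If all chords are almost as long as the corresponding arcs, with a quartic error for the
squares, then the curve is differentiable with constant speed. -/
lemma differentiable_of_chord_sq_ge {γ : ℝ → ℝ × ℝ} {L K T t₀ : ℝ} (hL : 0 ≤ L)
    (hK : 0 ≤ K) (hT : T < 1) (h₀ : 0 ≤ t₀) (h₁ : t₀ < T)
    (hup : ∀ s t, 0 ≤ s → s ≤ t → t ≤ T →
      ((γ t).1 - (γ s).1) ^ 2 + ((γ t).2 - (γ s).2) ^ 2 ≤ (L * (t - s)) ^ 2)
    (hlow : ∀ s t, 0 ≤ s → s < t → t ≤ T → (L * (t - s)) ^ 2 - K * (t - s) ^ 4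
      ≤ ((γ t).1 - (γ s).1) ^ 2 + ((γ t).2 - (γ s).2) ^ 2) :
    DifferentiableWithinAt ℝ γ (Icc 0 1) t₀ ∧ gSpeed γ t₀ = L := by
  have hchord : ∀ a b, 0 ≤ a → a < b → b ≤ T → ∀ s, 0 ≤ s → s ≤ 1 →
      ((γ (a + s * (b - a))).1 - ((γ a).1 + s * ((γ b).1 - (γ a).1))) ^ 2
      + ((γ (a + s * (b - a))).2 - ((γ a).2 + s * ((γ b).2 - (γ a).2))) ^ 2
      ≤ (Real.sqrt K * (b - a) ^ 2) ^ 2 := by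
    intro a b ha hab hb s hs0 hs1
    have hba : 0 < b - a := by linarith
    have g1 : s * (b - a) ≤ b - a := mul_le_of_le_one_left hba.le hs1
    have g0 : 0 ≤ s * (b - a) := by positivity
    have e1 := hup a (a + s * (b - a)) ha (by linarith) (by linarith)
    have e2 := hup (a + s * (b - a)) b (by linarith) (by linarith) hb
    have e3 := hlow a b ha hab hb
    have := dist_segment_sq_le (l := L * (b - a)) hs0 hs1 (by convert e1 using 2; ring)
      (by convert e2 using 2; ring) e3
    refine this.trans ?_
    rw [mul_pow (Real.sqrt K), Real.sq_sqrt hK, sub_sub_cancel, ← pow_mul]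
    have : s * (1 - s) ≤ 1 := by nlinarith
    exact mul_le_of_le_one_left (by positivity) this
  have dx : DifferentiableWithinAt ℝ (fun t => (γ t).1) (Icc 0 1) t₀ := by
    refine differentiableWithinAt_of_chord_bound (Real.sqrt_nonneg K) hT
      (fun a b ha hab hb s hs0 hs1 => ?_) h₀ h₁
    refine abs_le_of_sq_le_sq ?_ (by positivity)
    refine le_trans ?_ (hchord a b ha hab hb s hs0 hs1)
    exact le_add_of_nonneg_right (sq_nonneg _)
  have dy : DifferentiableWithinAt ℝ (fun t => (γ t).2) (Icc 0 1) t₀ := by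
    refine differentiableWithinAt_of_chord_bound (Real.sqrt_nonneg K) hT
      (fun a b ha hab hb s hs0 hs1 => ?_) h₀ h₁
    refine abs_le_of_sq_le_sq ?_ (by positivity)
    refine le_trans ?_ (hchord a b ha hab hb s hs0 hs1)
    exact le_add_of_nonneg_left (sq_nonneg _)
  refine ⟨dx.prodMk dy, ?_⟩
  have hNe : (𝓝[>] t₀).NeBot := inferInstance
  have hmem : Ioo t₀ T ∈ 𝓝[>] t₀ := Ioo_mem_nhdsGT h₁
  have hsub : 𝓝[>] t₀ ≤ 𝓝[Icc (0:ℝ) 1 \ {t₀}] t₀ := by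
    rw [← nhdsWithin_Ioo_eq_nhdsGT h₁]
    refine nhdsWithin_mono _ fun t ht => ⟨⟨h₀.trans ht.1.le, by linarith [ht.2]⟩, ht.1.ne'⟩
  have lx := (hasDerivWithinAt_iff_tendsto_slope.1 dx.hasDerivWithinAt).mono_left hsub
  have ly := (hasDerivWithinAt_iff_tendsto_slope.1 dy.hasDerivWithinAt).mono_left hsub
  have lim1 := (lx.pow 2).add (ly.pow 2)
  have hslope : ∀ t ∈ Ioo t₀ T, slope (fun t => (γ t).1) t₀ t ^ 2
      + slope (fun t => (γ t).2) t₀ t ^ 2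
      = (((γ t).1 - (γ t₀).1) ^ 2 + ((γ t).2 - (γ t₀).2) ^ 2) / (t - t₀) ^ 2 := by
    intro t ht
    rw [slope_def_field, slope_def_field, div_pow, div_pow, add_div]
  have lim2 : Tendsto (fun t => slope (fun t => (γ t).1) t₀ t ^ 2
      + slope (fun t => (γ t).2) t₀ t ^ 2) (𝓝[>] t₀) (𝓝 (L ^ 2)) := by
    have l0 : Tendsto (fun t => L ^ 2 - K * (t - t₀) ^ 2) (𝓝[>] t₀) (𝓝 (L ^ 2)) := by
      have : Continuous fun t => L ^ 2 - K * (t - t₀) ^ 2 := by fun_prop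
      have h2 := (this.tendsto t₀).mono_left (nhdsWithin_le_nhds (s := Ioi t₀))
      simpa using h2
    refine tendsto_of_tendsto_of_tendsto_of_le_of_le' l0 tendsto_const_nhds ?_ ?_
    · filter_upwards [hmem] with t ht
      have hpos : 0 < t - t₀ := sub_pos.2 ht.1
      rw [hslope t ht, le_div_iff₀ (by positivity)]
      have := hlow t₀ t h₀ ht.1 ht.2.le
      nlinarith
    · filter_upwards [hmem] with t ht
      have hpos : 0 < t - t₀ := sub_pos.2 ht.1
      rw [hslope t ht, div_le_iff₀ (by positivity)]
      have := hup t₀ t h₀ ht.1.le ht.2.le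
      nlinarith
  have heq := tendsto_nhds_unique lim1 lim2
  unfold gSpeed gSpeedOn
  rw [heq, Real.sqrt_sq hL]

/-- The curve obtained from `γ` by replacing its arc over `[a,b]` by the chord. -/
def shortcut (γ : ℝ → ℝ × ℝ) (a b t : ℝ) : ℝ × ℝ :=
  γ t + (γ a + ((max a (min b t) - a) / (b - a)) • (γ b - γ a) - γ (max a (min b t)))

lemma shortcut_of_le {γ : ℝ → ℝ × ℝ} {a b t : ℝ} (hab : a < b) (ht : t ≤ a) :
    shortcut γ a b t = γ t := by
  simp [shortcut, min_eq_right (ht.trans hab.le), max_eq_left ht]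

lemma shortcut_of_ge {γ : ℝ → ℝ × ℝ} {a b t : ℝ} (hab : a < b) (ht : b ≤ t) :
    shortcut γ a b t = γ t := by
  have : b - a ≠ 0 := (sub_pos.2 hab).ne'
  simp [shortcut, min_eq_left ht, max_eq_right hab.le, div_self this]

lemma shortcut_of_mem {γ : ℝ → ℝ × ℝ} {a b t : ℝ} (ht : t ∈ Icc a b) :
    shortcut γ a b t = γ a + ((t - a) / (b - a)) • (γ b - γ a) := by
  simp [shortcut, min_eq_right ht.2, max_eq_right ht.1]

lemma shortcut_fst {γ : ℝ → ℝ × ℝ} {a b t : ℝ} (ht : t ∈ Icc a b) :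
    (shortcut γ a b t).1 = (γ a).1 + (t - a) / (b - a) * ((γ b).1 - (γ a).1) := by
  simp [shortcut_of_mem ht]

lemma shortcut_snd {γ : ℝ → ℝ × ℝ} {a b t : ℝ} (ht : t ∈ Icc a b) :
    (shortcut γ a b t).2 = (γ a).2 + (t - a) / (b - a) * ((γ b).2 - (γ a).2) := by
  simp [shortcut_of_mem ht]

lemma shortcut_lipschitz {γ : ℝ → ℝ × ℝ} {a b : ℝ} (ha : 0 ≤ a) (hab : a < b) (hb : b ≤ 1)
    (h : ∃ K, LipschitzOnWith K γ (Icc 0 1)) :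
    ∃ K, LipschitzOnWith K (shortcut γ a b) (Icc 0 1) := by
  obtain ⟨K, hK⟩ := h
  have hclamp : LipschitzWith 1 fun t : ℝ => max a (min b t) :=
    (LipschitzWith.id.const_min b).const_max a
  have hmaps : MapsTo (fun t : ℝ => max a (min b t)) (Icc 0 1) (Icc 0 1) := fun t _ =>
    ⟨ha.trans (le_max_left _ _), max_le (hab.le.trans hb) ((min_le_left _ _).trans hb)⟩
  have h1 : LipschitzOnWith (K * 1) (fun t : ℝ => γ (max a (min b t))) (Icc 0 1) :=
    hK.comp (hclamp.lipschitzOnWith) hmaps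
  have h2 : ∃ K', LipschitzWith K' fun u : ℝ => γ a + ((u - a) / (b - a)) • (γ b - γ a) := by
    refine ⟨(dist (γ b) (γ a) / (b - a)).toNNReal, LipschitzWith.of_dist_le_mul fun u v => ?_⟩
    have hba : 0 < b - a := sub_pos.2 hab
    rw [Real.coe_toNNReal _ (by positivity), dist_add_left, dist_eq_norm, ← sub_smul, norm_smul,
      ← sub_div, sub_sub_sub_cancel_right, norm_div, Real.norm_of_nonneg hba.le, dist_eq_norm,
      dist_eq_norm]
    apply le_of_eq
    ring
  obtain ⟨K', hK'⟩ := h2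
  have h3 : LipschitzOnWith (K' * 1)
      (fun t : ℝ => γ a + ((max a (min b t) - a) / (b - a)) • (γ b - γ a)) (Icc 0 1) :=
    (hK'.comp hclamp).lipschitzOnWith
  exact ⟨_, hK.add (h3.sub h1)⟩

lemma shortcut_memRg {γ : ℝ → ℝ × ℝ} {a b x0 y0 : ℝ} (ha : 0 ≤ a) (hab : a < b) (hb : b < 1)
    (h : MemRg x0 y0 γ) : MemRg x0 y0 (shortcut γ a b) := by
  obtain ⟨hlip, h0, h1, hinterior⟩ := h
  refine ⟨shortcut_lipschitz ha hab hb.le hlip, ?_, ?_, fun t ht => ?_⟩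
  · rw [shortcut_of_le hab ha, h0]
  · rwa [shortcut_of_ge hab hb.le]
  · by_cases hta : t ≤ a
    · rw [shortcut_of_le hab hta]; exact hinterior t ht
    by_cases htb : b ≤ t
    · rw [shortcut_of_ge hab htb]; exact hinterior t ht
    push Not at hta htb
    have hI : t ∈ Icc a b := ⟨hta.le, htb.le⟩
    have hba : 0 < b - a := sub_pos.2 hab
    have pa := hinterior a ⟨ha, hab.trans hb⟩
    have pb := hinterior b ⟨ha.trans hab.le, hb⟩
    have hs0 : 0 < (t - a) / (b - a) := div_pos (by linarith) hba
    have hs1 : (t - a) / (b - a) ≤ 1 := by rw [div_le_one hba]; linarith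
    constructor
    · rw [shortcut_fst hI]
      have := mul_nonneg (sub_nonneg.2 hs1) pa.1.le
      have := mul_pos hs0 pb.1
      linarith
    · rw [shortcut_snd hI]
      have := mul_nonneg (sub_nonneg.2 hs1) pa.2.le
      have := mul_pos hs0 pb.2
      linarith

lemma shortcut_speed_mem {γ : ℝ → ℝ × ℝ} {a b t : ℝ} (ha : 0 ≤ a) (hb : b ≤ 1)
    (ht : t ∈ Ioo a b) :
    gSpeed (shortcut γ a b) t
      = Real.sqrt (((γ b).1 - (γ a).1) ^ 2 + ((γ b).2 - (γ a).2) ^ 2) / (b - a) := by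
  have hba : 0 < b - a := by linarith [ht.1, ht.2]
  have hder : ∀ p q : ℝ, deriv (fun u => p + (u - a) / (b - a) * q) t = q / (b - a) := by
    intro p q
    have h : HasDerivAt (fun u => p + (u - a) / (b - a) * q) (1 / (b - a) * q) t :=
      ((((hasDerivAt_id t).sub_const a).div_const (b - a)).mul_const q).const_add p
    rw [h.deriv]; ring
  have hn : Ioo a b ∈ 𝓝 t := Ioo_mem_nhds ht.1 ht.2
  have e1 : (fun u => (shortcut γ a b u).1)
      =ᶠ[𝓝 t] fun u => (γ a).1 + (u - a) / (b - a) * ((γ b).1 - (γ a).1) := by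
    filter_upwards [hn] with u hu using shortcut_fst (Ioo_subset_Icc_self hu)
  have e2 : (fun u => (shortcut γ a b u).2)
      =ᶠ[𝓝 t] fun u => (γ a).2 + (u - a) / (b - a) * ((γ b).2 - (γ a).2) := by
    filter_upwards [hn] with u hu using shortcut_snd (Ioo_subset_Icc_self hu)
  rw [gSpeed_eq_deriv ⟨ha.trans_lt ht.1, ht.2.trans_le hb⟩, e1.deriv_eq, e2.deriv_eq, hder, hder,
    div_pow, div_pow, ← add_div, Real.sqrt_div' _ (by positivity), Real.sqrt_sq hba.le]

lemma shortcut_speed_notMem {γ : ℝ → ℝ × ℝ} {a b t : ℝ} (hab : a < b) (ht : t ∈ Ioo (0:ℝ) 1)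
    (hI : t ∉ Icc a b) : gSpeed (shortcut γ a b) t = gSpeed γ t := by
  have hn : (Icc a b)ᶜ ∈ 𝓝 t := isClosed_Icc.isOpen_compl.mem_nhds hI
  have e : shortcut γ a b =ᶠ[𝓝 t] γ := by
    filter_upwards [hn] with u hu
    rw [mem_compl_iff, mem_Icc, not_and_or, not_le, not_le] at hu
    rcases hu with hu | hu
    · exact shortcut_of_le hab hu.le
    · exact shortcut_of_ge hab hu.le
  rw [gSpeed_eq_deriv ht, gSpeed_eq_deriv ht]
  have e1 : (fun u => (shortcut γ a b u).1) =ᶠ[𝓝 t] fun u => (γ u).1 := e.fun_comp Prod.fst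
  have e2 : (fun u => (shortcut γ a b u).2) =ᶠ[𝓝 t] fun u => (γ u).2 := e.fun_comp Prod.snd
  rw [e1.deriv_eq, e2.deriv_eq]

lemma Fvol_le_mul {n : ℕ} {cn m e : ℝ} {z z' : ℝ × ℝ} (hcn : 0 < cn) (hm : 0 < m)
    (hx : m ≤ z.1) (hy : m ≤ z.2) (hx' : m ≤ z'.1) (hy' : m ≤ z'.2)
    (he : (z'.1 - z.1) ^ 2 + (z'.2 - z.2) ^ 2 ≤ e ^ 2) (he0 : 0 ≤ e) :
    Fvol n cn z' ≤ (1 + e / m) ^ (2 * (n - 1)) * Fvol n cn z := by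
  have key : ∀ u u' : ℝ, m ≤ u → (u' - u) ^ 2 ≤ e ^ 2 → u' ≤ (1 + e / m) * u := by
    intro u u' hu hd
    have h1 := (abs_le_of_sq_le_sq' hd he0).2
    have h2 : e ≤ e / m * u := by
      rw [div_mul_eq_mul_div, le_div_iff₀ hm]; gcongr
    linarith
  have k1 := key z.1 z'.1 hx (by linarith [sq_nonneg (z'.2 - z.2)])
  have k2 := key z.2 z'.2 hy (by linarith [sq_nonneg (z'.1 - z.1)])
  have p1 : z'.1 ^ (n - 1) ≤ ((1 + e / m) * z.1) ^ (n - 1) := by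
    have := hm.trans_le hx'
    gcongr
  have p2 : z'.2 ^ (n - 1) ≤ ((1 + e / m) * z.2) ^ (n - 1) := by
    have := hm.trans_le hy'
    gcongr
  have := hm.trans_le hx
  have := hm.trans_le hy
  have := hm.trans_le hx'
  have := hm.trans_le hy'
  unfold Fvol
  calc cn * z'.1 ^ (n - 1) * z'.2 ^ (n - 1)
      ≤ cn * ((1 + e / m) * z.1) ^ (n - 1) * ((1 + e / m) * z.2) ^ (n - 1) := by gcongr
    _ = _ := by rw [mul_pow, mul_pow, mul_comm 2, pow_mul, sq]; ring

/-- A chord much shorter than its arc has length ratio beyond the admissible distortion of the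
weight. -/
lemma distortion_lt_ratio {N : ℕ} {l d m : ℝ} (hm : 0 < m) (hd : 0 < d) (hdl : d ≤ l)
    (h : d ^ 2 < l ^ 2 - (N / m) ^ 2 * l ^ 4) :
    (1 + Real.sqrt (l ^ 2 - d ^ 2) / 2 / m) ^ N < l / d := by
  have hl : 0 < l := hd.trans_le hdl
  set q := l ^ 2 - d ^ 2 with hq
  have hq0 : 0 ≤ q := by rw [hq]; nlinarith
  set r := Real.sqrt q with hr
  have hr0 : 0 ≤ r := Real.sqrt_nonneg _
  have hr2 : r ^ 2 = q := Real.sq_sqrt hq0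
  set x := r / 2 / m with hx
  have hx0 : 0 ≤ x := by positivity
  have hNr : N / m * l ^ 2 < r := by
    apply lt_of_pow_lt_pow_left₀ 2 hr0
    rw [hr2, mul_pow, ← pow_mul]
    simp only [Nat.reduceMul]
    linarith
  have hrpos : 0 < r := lt_of_le_of_lt (by positivity) hNr
  have hB := one_add_mul_le_pow (a := -(x / (1 + x))) (by
    have : x / (1 + x) ≤ 1 := by rw [div_le_one (by positivity)]; linarith
    linarith) N
  have hB2 : (1 + -(x / (1 + x))) ^ N = ((1 + x) ^ N)⁻¹ := by
    rw [← inv_pow]; congr 1; field_simp; ring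
  have hxx : x / (1 + x) ≤ x := div_le_self hx0 (by linarith)
  have hN0 : (0:ℝ) ≤ N := Nat.cast_nonneg N
  have h1 : 1 - N * x ≤ ((1 + x) ^ N)⁻¹ := by
    rw [← hB2]; refine le_trans ?_ hB
    nlinarith
  have h2 : l * (N * x) < l - d := by
    have e1 : l * (N * x) = (N / m * l ^ 2) * r / (2 * l) := by
      rw [hx]; field_simp
    have e2 : (N / m * l ^ 2) * r < r ^ 2 := by nlinarith
    have e3 : r ^ 2 ≤ (l - d) * (2 * l) := by
      rw [hr2, hq]; nlinarith
    rw [e1, div_lt_iff₀ (by positivity)]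
    linarith
  have h3 : d < l * ((1 + x) ^ N)⁻¹ := by nlinarith
  rw [lt_div_iff₀ hd]
  rw [← div_eq_mul_inv, lt_div_iff₀ (by positivity)] at h3
  linarith

/-- The absolute slope of a test function on `[0,1]`. -/
def absSlope (w : ℝ → ℝ) : ℝ → ℝ := (Ioo (0:ℝ) 1).indicator fun t => |deriv w t|

lemma absSlope_eq {w : ℝ → ℝ} {t : ℝ} (ht : t ∈ Ioo (0:ℝ) 1) :
    |derivWithin w (Icc 0 1) t| = absSlope w t := by
  rw [absSlope, indicator_of_mem ht, derivWithin_of_mem_nhds (Icc_mem_nhds ht.1 ht.2)]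

lemma isSlope_absSlope {w : ℝ → ℝ} (hw : ∃ K, LipschitzOnWith K w (Icc 0 1)) :
    IsSlope (absSlope w) := by
  obtain ⟨K, hK⟩ := hw
  refine ⟨(measurable_deriv w).norm.indicator measurableSet_Ioo,
    fun t => indicator_nonneg (fun _ _ => abs_nonneg _) t, K, fun t => ?_⟩
  refine indicator_apply_le' (fun ht => ?_) fun _ => K.2
  exact norm_deriv_le_of_lipschitzOn (Icc_mem_nhds ht.1 ht.2) hK

lemma abs_le_prim_absSlope {w : ℝ → ℝ} (hw : ∃ K, LipschitzOnWith K w (Icc 0 1)) (h0 : w 0 = 0)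
    {t : ℝ} (ht : t ∈ Icc (0:ℝ) 1) : |w t| ≤ prim (absSlope w) t := by
  have ac := absolutelyContinuous_of_lipschitzOn hw le_rfl ht.1 ht.2
  have e := ac.integral_deriv_eq_sub
  rw [h0, sub_zero] at e
  rw [← e]
  rw [← Real.norm_eq_abs]
  refine (intervalIntegral.norm_integral_le_integral_norm ht.1).trans ?_
  refine intervalIntegral.integral_mono_ae_restrict ht.1 ac.intervalIntegrable_deriv.norm
    ((isSlope_absSlope hw).intervalIntegrable _ _) ?_
  rw [← Measure.restrict_congr_set (Ioo_ae_eq_Icc (α := ℝ) (μ := volume)), EventuallyLE,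
    ae_restrict_iff' measurableSet_Ioo]
  refine Eventually.of_forall fun s hs => ?_
  rw [absSlope, indicator_of_mem (show s ∈ Ioo (0:ℝ) 1 from ⟨hs.1, hs.2.trans_le ht.2⟩)]
  rfl

lemma derivWithin_prim_ae {f : ℝ → ℝ} (hf : IsSlope f) :
    ∀ᵐ t ∂(volume : Measure ℝ), t ∈ Icc (0:ℝ) 1 → derivWithin (prim f) (Icc 0 1) t = f t := by
  filter_upwards [(hf.intervalIntegrable 0 1).ae_hasDerivAt_integral] with t ht hmem
  rw [uIcc_of_le zero_le_one] at ht
  exact (ht hmem 0 ⟨le_rfl, zero_le_one⟩).hasDerivWithinAt.derivWithin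
    (uniqueDiffOn_Icc zero_lt_one t hmem)

lemma ae_uIoc {P : ℝ → Prop} (h : ∀ᵐ t ∂(volume : Measure ℝ), t ∈ Ioo (0:ℝ) 1 → P t) :
    ∀ᵐ t ∂(volume.restrict (uIoc (0:ℝ) 1)), P t := by
  rw [uIoc_of_le zero_le_one,
    ← Measure.restrict_congr_set (Ioo_ae_eq_Ioc (α := ℝ) (μ := volume)),
    ae_restrict_iff' measurableSet_Ioo]
  exact h

lemma ae_Icc {P : ℝ → Prop} (h : ∀ᵐ t ∂(volume : Measure ℝ), t ∈ Ioo (0:ℝ) 1 → P t) :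
    ∀ᵐ t ∂(volume.restrict (Icc (0:ℝ) 1)), P t := by
  rw [← Measure.restrict_congr_set (Ioo_ae_eq_Icc (α := ℝ) (μ := volume)),
    ae_restrict_iff' measurableSet_Ioo]
  exact h

lemma integral_congr_Ioo {f g : ℝ → ℝ}
    (h : ∀ᵐ t ∂(volume : Measure ℝ), t ∈ Ioo (0:ℝ) 1 → f t = g t) :
    ∫ t in (0:ℝ)..1, f t = ∫ t in (0:ℝ)..1, g t :=
  intervalIntegral.integral_congr_ae_restrict (ae_uIoc h)

lemma intervalIntegrable_congr_Ioo {f g : ℝ → ℝ}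
    (h : ∀ᵐ t ∂(volume : Measure ℝ), t ∈ Ioo (0:ℝ) 1 → f t = g t)
    (hg : IntervalIntegrable g volume 0 1) : IntervalIntegrable f volume 0 1 :=
  hg.congr_ae ((ae_uIoc h).mono fun _ ht => ht.symm)

lemma continuousOn_Fvol_comp {n : ℕ} {cn : ℝ} {γ : ℝ → ℝ × ℝ}
    (h : ∃ K, LipschitzOnWith K γ (Icc 0 1)) :
    ContinuousOn (fun t => Fvol n cn (γ t)) (Icc 0 1) := by
  have hc := h.choose_spec.continuousOn
  unfold Fvol
  exact (continuousOn_const.mul (hc.fst.pow _)).mul (hc.snd.pow _)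

lemma Fvol_pos {n : ℕ} {cn : ℝ} (hcn : 0 < cn) {z : ℝ × ℝ} (hz : z ∈ Pint) : 0 < Fvol n cn z := by
  have := hz.1
  have := hz.2
  unfold Fvol
  positivity

lemma MemRg.Fvol_nonneg {n : ℕ} {cn x0 y0 : ℝ} (hcn : 0 < cn) {γ : ℝ → ℝ × ℝ}
    (h : MemRg x0 y0 γ) : ∀ t ∈ Icc (0:ℝ) 1, 0 ≤ Fvol n cn (γ t) := by
  intro t ht
  rcases ht.2.eq_or_lt with rfl | h1
  · have := h.2.2.1.1.1
    have := h.2.2.1.1.2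
    unfold Fvol
    positivity
  · exact (Fvol_pos hcn (h.2.2.2 t ⟨ht.1, h1⟩)).le

lemma weightData_of_vcoord {n : ℕ} {cn p x0 y0 c : ℝ} (hn : 2 ≤ n) (hcn : 0 < cn)
    (hp : 2 * (n : ℝ) - 1 ≤ p) {γ : ℝ → ℝ × ℝ} (h : MemRg x0 y0 γ) (hc : 0 < c)
    (hv : ∀ t ∈ Icc (0:ℝ) 1, c * (1 - t) ≤ vcoord (γ t)) :
    WeightData p (cn * c ^ (n - 1)) (fun t => Fvol n cn (γ t))
      fun t => (1 - t) ^ (-(1 / 2) : ℝ) where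
  one_lt := by
    have : (2:ℝ) ≤ n := by exact_mod_cast hn
    linarith
  c_pos := by positivity
  cont := continuousOn_Fvol_comp h.1
  pos := fun t ht => Fvol_pos hcn (h.2.2.2 t ht)
  nonneg := h.Fvol_nonneg hcn
  H_pos := fun t ht => Real.rpow_pos_of_pos (sub_pos.2 ht.2) _
  H_int := by
    have h1 : IntervalIntegrable (fun x : ℝ => x ^ (-(1 / 2) : ℝ)) volume 0 1 :=
      intervalIntegral.intervalIntegrable_rpow' (by norm_num)
    have h2 := (h1.comp_sub_left 1).symm
    simpa using h2
  lower := fun t ht => by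
    have h1 : 0 < 1 - t := sub_pos.2 ht.2
    have e1 : cn * (c ^ (n - 1) * (1 - t) ^ (n - 1)) ≤ Fvol n cn (γ t) := by
      unfold Fvol
      rw [mul_assoc, ← mul_pow, ← mul_pow]
      have := hv t ⟨ht.1.le, ht.2.le⟩
      unfold vcoord at this
      gcongr
    have e2 : (1:ℝ) ≤ (1 - t) ^ (n - 1) * ((1 - t) ^ (-(1 / 2) : ℝ)) ^ (p - 1) := by
      rw [← Real.rpow_mul h1.le, ← Real.rpow_natCast, ← Real.rpow_add h1]
      refine Real.one_le_rpow_of_pos_of_le_one_of_nonpos h1 (by linarith [ht.1]) ?_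
      rw [Nat.cast_sub (by lia)]
      push_cast
      linarith
    have e3 : 0 ≤ ((1 - t) ^ (-(1 / 2) : ℝ)) ^ (p - 1) := by positivity
    have e4 : 0 < cn * c ^ (n - 1) := by positivity
    calc cn * c ^ (n - 1) ≤ cn * c ^ (n - 1) *
          ((1 - t) ^ (n - 1) * ((1 - t) ^ (-(1 / 2) : ℝ)) ^ (p - 1)) :=
          le_mul_of_one_le_right e4.le e2
      _ = cn * (c ^ (n - 1) * (1 - t) ^ (n - 1)) * ((1 - t) ^ (-(1 / 2) : ℝ)) ^ (p - 1) := by ring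
      _ ≤ _ := by gcongr

lemma lambdaG_le_quotient {n : ℕ} {cn p x0 y0 : ℝ} (hcn : 0 < cn) {γ : ℝ → ℝ × ℝ}
    (h : MemRg x0 y0 γ) {w : ℝ → ℝ} (hw : ∃ K, LipschitzOnWith K w (Icc 0 1)) (h0 : w 0 = 0)
    (hnum : IntervalIntegrable (numG n cn p (Icc 0 1) γ w) volume 0 1)
    (hden : IntervalIntegrable (denG n cn p (Icc 0 1) γ w) volume 0 1)
    (hpos : 0 < ∫ t in (0:ℝ)..1, denG n cn p (Icc 0 1) γ w t) :
    lambdaG n cn p γ ≤ (∫ t in (0:ℝ)..1, numG n cn p (Icc 0 1) γ w t)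
      / ∫ t in (0:ℝ)..1, denG n cn p (Icc 0 1) γ w t := by
  refine csInf_le ⟨0, ?_⟩ ⟨w, hw, h0, hnum, hden, hpos, rfl⟩
  rintro q ⟨v, -, -, -, -, hv, rfl⟩
  refine div_nonneg (intervalIntegral.integral_nonneg zero_le_one fun t ht => ?_) hv.le
  have := h.Fvol_nonneg (n := n) hcn t ht
  have : 0 ≤ gSpeedOn (Icc 0 1) γ t := Real.sqrt_nonneg _
  unfold numG
  positivity

lemma lambdaG_lower {n : ℕ} {cn p x0 y0 L : ℝ} (hcn : 0 < cn) (hp : 0 ≤ p) (hL : 0 < L)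
    {γ : ℝ → ℝ × ℝ} (h : MemRg x0 y0 γ)
    (hspeed : ∀ᵐ t ∂(volume : Measure ℝ), t ∈ Icc (0:ℝ) 1 → gSpeed γ t = L)
    {f : ℝ → ℝ} (hf : IsSlope f) :
    lambdaG n cn p γ * L ^ p * ∫ t in (0:ℝ)..1, prim f t ^ p * Fvol n cn (γ t)
      ≤ ∫ t in (0:ℝ)..1, f t ^ p * Fvol n cn (γ t) := by
  have hcont := continuousOn_Fvol_comp (n := n) (cn := cn) h.1
  have hcu : ContinuousOn (fun t => Fvol n cn (γ t)) (uIcc 0 1) := by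
    rwa [uIcc_of_le zero_le_one]
  have inum := hf.integrable_rpow_mul hp hcu
  have iden := hf.integrable_prim_rpow_mul hp hcu
  have anum : ∀ᵐ t ∂(volume : Measure ℝ), t ∈ Ioo (0:ℝ) 1 →
      numG n cn p (Icc 0 1) γ (prim f) t = f t ^ p * Fvol n cn (γ t) * L ^ (1 - p) := by
    filter_upwards [hspeed, derivWithin_prim_ae hf] with t h1 h2 ht
    have ht' := Ioo_subset_Icc_self ht
    have h3 : gSpeedOn (Icc 0 1) γ t = L := h1 ht'
    rw [numG, h3, h2 ht', abs_of_nonneg (hf.2.1 t)]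
  have aden : ∀ᵐ t ∂(volume : Measure ℝ), t ∈ Ioo (0:ℝ) 1 →
      denG n cn p (Icc 0 1) γ (prim f) t = prim f t ^ p * Fvol n cn (γ t) * L := by
    filter_upwards [hspeed] with t h1 ht
    have h3 : gSpeedOn (Icc 0 1) γ t = L := h1 (Ioo_subset_Icc_self ht)
    rw [denG, h3, abs_of_nonneg (hf.prim_nonneg ht.1.le)]
  have hD0 : 0 ≤ ∫ t in (0:ℝ)..1, prim f t ^ p * Fvol n cn (γ t) :=
    intervalIntegral.integral_nonneg zero_le_one fun t ht =>
      mul_nonneg (Real.rpow_nonneg (hf.prim_nonneg ht.1) p) (h.Fvol_nonneg hcn t ht)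
  have hN0 : 0 ≤ ∫ t in (0:ℝ)..1, f t ^ p * Fvol n cn (γ t) :=
    intervalIntegral.integral_nonneg zero_le_one fun t ht =>
      mul_nonneg (Real.rpow_nonneg (hf.2.1 t) p) (h.Fvol_nonneg hcn t ht)
  rcases hD0.eq_or_lt with hD | hD
  · rw [← hD, mul_zero]; exact hN0
  have enum := integral_congr_Ioo anum
  have eden := integral_congr_Ioo aden
  rw [intervalIntegral.integral_mul_const] at enum eden
  have hle := lambdaG_le_quotient hcn h
    (hf.exists_lipschitz.imp fun K hK => hK.lipschitzOnWith)
    (by simp [prim]) (intervalIntegrable_congr_Ioo anum (inum.mul_const _))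
    (intervalIntegrable_congr_Ioo aden (iden.mul_const _))
    (by rw [eden]; positivity)
  rw [enum, eden, le_div_iff₀ (by positivity)] at hle
  have e : L ^ (1 - p) * L ^ p = L := by
    rw [← Real.rpow_add hL, sub_add_cancel, Real.rpow_one]
  have hLp : 0 < L ^ p := by positivity
  have h5 := mul_le_mul_of_nonneg_right hle hLp.le
  rw [mul_assoc _ (L ^ (1 - p)), e] at h5
  refine le_of_mul_le_mul_right ?_ hL
  linarith

lemma integral_add_subinterval {u : ℝ → ℝ} {a b k : ℝ} (ha : 0 ≤ a) (hab : a ≤ b) (hb : b ≤ 1)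
    (hu : IntervalIntegrable u volume 0 1) :
    IntervalIntegrable (fun t => u t + k * (Ioo a b).indicator u t) volume 0 1 ∧
    ∫ t in (0:ℝ)..1, (u t + k * (Ioo a b).indicator u t)
      = (∫ t in (0:ℝ)..1, u t) + k * ∫ t in a..b, u t := by
  have hsub : Ioo a b ⊆ Ioc 0 1 := Ioo_subset_Ioc_self.trans (Ioc_subset_Ioc ha hb)
  have hi : IntervalIntegrable ((Ioo a b).indicator u) volume 0 1 := by
    rw [intervalIntegrable_iff_integrableOn_Ioc_of_le zero_le_one] at hu ⊢
    exact hu.indicator measurableSet_Ioo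
  refine ⟨hu.add (hi.const_mul k), ?_⟩
  rw [intervalIntegral.integral_add hu (hi.const_mul k), intervalIntegral.integral_const_mul]
  congr 2
  rw [intervalIntegral.integral_of_le zero_le_one, setIntegral_indicator measurableSet_Ioo,
    inter_eq_right.2 hsub, intervalIntegral.integral_of_le hab, integral_Ioc_eq_integral_Ioo]

/-- A shortcut that improves both integrands of the Rayleigh quotient, the numerator by a
definite factor, strictly increases the eigenvalue. -/
lemma lambdaG_lt_shortcut {n : ℕ} {cn p x0 y0 L c a b r k : ℝ} (hn : 2 ≤ n) (hcn : 0 < cn)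
    (hp : 2 * (n : ℝ) - 1 ≤ p) (hL : 0 < L) {γ : ℝ → ℝ × ℝ} (h : MemRg x0 y0 γ)
    (hspeed : ∀ᵐ t ∂(volume : Measure ℝ), t ∈ Icc (0:ℝ) 1 → gSpeed γ t = L) (hc : 0 < c)
    (hv : ∀ t ∈ Icc (0:ℝ) 1, c * (1 - t) ≤ vcoord (γ t)) (ha : 0 ≤ a) (hab : a < b) (hb : b < 1)
    (hr : 0 < r) (hk : 0 < k)
    (hrI : ∀ t ∈ Ioo a b, gSpeed (shortcut γ a b) t = r)
    (hnumI : ∀ t ∈ Ioo a b, (1 + k) * (Fvol n cn (γ t) * L ^ (1 - p))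
      ≤ Fvol n cn (shortcut γ a b t) * r ^ (1 - p))
    (hdenI : ∀ t ∈ Ioo a b, Fvol n cn (shortcut γ a b t) * r ≤ Fvol n cn (γ t) * L) :
    lambdaG n cn p γ < lambdaG n cn p (shortcut γ a b) := by
  have hwd := weightData_of_vcoord hn hcn hp h hc hv
  have hp1 := hwd.one_lt
  have hp0 : 0 ≤ p := by linarith
  have hσ := shortcut_memRg ha hab hb h
  obtain ⟨η, hη, hgap⟩ := hwd.exists_gap ha hab hb hk
    fun f hf => lambdaG_lower hcn hp0 hL h hspeed hf
  have hcu : ContinuousOn (fun t => Fvol n cn (γ t)) (uIcc 0 1) := by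
    rw [uIcc_of_le zero_le_one]; exact hwd.cont
  have hcσ : ContinuousOn (fun t => Fvol n cn (shortcut γ a b t)) (uIcc 0 1) := by
    rw [uIcc_of_le zero_le_one]; exact continuousOn_Fvol_comp hσ.1
  have haeσ : ∀ᵐ t ∂(volume : Measure ℝ), t ∈ Ioo (0:ℝ) 1 →
      (t ∈ Ioo a b ∧ gSpeed (shortcut γ a b) t = r) ∨
      (t ∉ Ioo a b ∧ gSpeed (shortcut γ a b) t = L ∧ shortcut γ a b t = γ t) := by
    filter_upwards [hspeed, Measure.ae_ne volume a, Measure.ae_ne volume b] with t h1 hta htb ht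
    by_cases htI : t ∈ Ioo a b
    · exact Or.inl ⟨htI, hrI t htI⟩
    have hI : t ∉ Icc a b := fun hI => htI ⟨lt_of_le_of_ne hI.1 (Ne.symm hta),
      lt_of_le_of_ne hI.2 htb⟩
    refine Or.inr ⟨htI, ?_, ?_⟩
    · rw [shortcut_speed_notMem hab ht hI, h1 (Ioo_subset_Icc_self ht)]
    · rw [mem_Icc, not_and_or, not_le, not_le] at hI
      rcases hI with hI | hI
      · exact shortcut_of_le hab hI.le
      · exact shortcut_of_ge hab hI.le
  have hLp : 0 < L ^ (-p) := by positivity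
  have hL1 : L ^ (1 - p) = L ^ (-p) * L := by
    rw [← Real.rpow_add_one hL.ne']; congr 1; ring
  have hbound : ∀ w : ℝ → ℝ, (∃ K, LipschitzOnWith K w (Icc 0 1)) → w 0 = 0 →
      IntervalIntegrable (numG n cn p (Icc 0 1) (shortcut γ a b) w) volume 0 1 →
      IntervalIntegrable (denG n cn p (Icc 0 1) (shortcut γ a b) w) volume 0 1 →
      (0 < ∫ t in (0:ℝ)..1, denG n cn p (Icc 0 1) (shortcut γ a b) w t) →
      lambdaG n cn p γ + η * L ^ (-p) ≤
        (∫ t in (0:ℝ)..1, numG n cn p (Icc 0 1) (shortcut γ a b) w t)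
          / ∫ t in (0:ℝ)..1, denG n cn p (Icc 0 1) (shortcut γ a b) w t := by
    intro w hw h0 inum iden hpos
    have hf := isSlope_absSlope hw
    set f := absSlope w with hfdef
    have iN := hf.integrable_rpow_mul hp0 hcu
    obtain ⟨iS, eS⟩ := integral_add_subinterval (k := k) ha hab.le hb.le iN
    have hG := hgap f hf
    rw [← eS] at hG
    have hnum : L ^ (1 - p) * (∫ t in (0:ℝ)..1, (f t ^ p * Fvol n cn (γ t)
        + k * (Ioo a b).indicator (fun t => f t ^ p * Fvol n cn (γ t)) t))
        ≤ ∫ t in (0:ℝ)..1, numG n cn p (Icc 0 1) (shortcut γ a b) w t := by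
      rw [← intervalIntegral.integral_const_mul]
      refine intervalIntegral.integral_mono_ae_restrict zero_le_one (iS.const_mul _) inum
        (ae_Icc ?_)
      filter_upwards [haeσ] with t h1 ht
      have hfp : 0 ≤ f t ^ p := Real.rpow_nonneg (hf.2.1 t) p
      rw [numG, absSlope_eq ht, ← hfdef]
      rcases h1 ht with ⟨htI, hs⟩ | ⟨htI, hs, he⟩
      · rw [show gSpeedOn (Icc 0 1) (shortcut γ a b) t = r from hs, indicator_of_mem htI]
        have := mul_le_mul_of_nonneg_left (hnumI t htI) hfp
        linarith
      · rw [show gSpeedOn (Icc 0 1) (shortcut γ a b) t = L from hs, indicator_of_notMem htI, he]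
        apply le_of_eq; ring
    have hden : ∫ t in (0:ℝ)..1, denG n cn p (Icc 0 1) (shortcut γ a b) w t
        ≤ L * ∫ t in (0:ℝ)..1, prim f t ^ p * Fvol n cn (γ t) := by
      rw [← intervalIntegral.integral_const_mul]
      refine intervalIntegral.integral_mono_ae_restrict zero_le_one iden
        ((hf.integrable_prim_rpow_mul hp0 hcu).const_mul _) (ae_Icc ?_)
      filter_upwards [haeσ] with t h1 ht
      have ht' := Ioo_subset_Icc_self ht
      have hwp : |w t| ^ p ≤ prim f t ^ p :=
        Real.rpow_le_rpow (abs_nonneg _) (abs_le_prim_absSlope hw h0 ht') hp0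
      have hFL : 0 ≤ Fvol n cn (γ t) * L := mul_nonneg (h.Fvol_nonneg hcn t ht') hL.le
      have hw0 : 0 ≤ |w t| ^ p := by positivity
      have key : |w t| ^ p * (Fvol n cn (γ t) * L) ≤ L * (prim f t ^ p * Fvol n cn (γ t)) := by
        have := mul_le_mul_of_nonneg_right hwp hFL
        linarith
      rw [denG, mul_assoc]
      rcases h1 ht with ⟨htI, hs⟩ | ⟨htI, hs, he⟩
      · rw [show gSpeedOn (Icc 0 1) (shortcut γ a b) t = r from hs]
        exact (mul_le_mul_of_nonneg_left (hdenI t htI) hw0).trans key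
      · rw [show gSpeedOn (Icc 0 1) (shortcut γ a b) t = L from hs, he]
        exact key
    have hl0 : 0 ≤ lambdaG n cn p γ := by
      refine Real.sInf_nonneg ?_
      rintro q ⟨v, -, -, -, -, hv', rfl⟩
      refine div_nonneg (intervalIntegral.integral_nonneg zero_le_one fun t ht => ?_) hv'.le
      have := h.Fvol_nonneg (n := n) hcn t ht
      have : 0 ≤ gSpeedOn (Icc 0 1) γ t := Real.sqrt_nonneg _
      unfold numG
      positivity
    rw [le_div_iff₀ hpos]
    have hLL : L ^ (-p) * L ^ p = 1 := by
      rw [← Real.rpow_add hL, neg_add_cancel, Real.rpow_zero]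
    calc (lambdaG n cn p γ + η * L ^ (-p)) * _
        ≤ (lambdaG n cn p γ + η * L ^ (-p))
          * (L * ∫ t in (0:ℝ)..1, prim f t ^ p * Fvol n cn (γ t)) := by gcongr
      _ = L ^ (1 - p) * ((lambdaG n cn p γ * L ^ p + η)
          * ∫ t in (0:ℝ)..1, prim f t ^ p * Fvol n cn (γ t)) := by
          rw [hL1]
          linear_combination (-(lambdaG n cn p γ * L
            * ∫ t in (0:ℝ)..1, prim f t ^ p * Fvol n cn (γ t))) * hLL
      _ ≤ _ := le_trans (mul_le_mul_of_nonneg_left hG (by positivity)) hnum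
  refine lt_of_lt_of_le (lt_add_of_pos_right _ (mul_pos hη hLp)) (le_csInf ?_ ?_)
  · have h1 : IsSlope fun _ => (1:ℝ) :=
      ⟨measurable_const, fun _ => zero_le_one, 1, fun _ => le_rfl⟩
    have hs : ∀ q : ℝ, IsSlope fun t => if t ∈ Ioo a b then r ^ q else L ^ q := fun q => by
      refine ⟨Measurable.ite measurableSet_Ioo measurable_const measurable_const, fun t => ?_,
        max (r ^ q) (L ^ q), fun t => ?_⟩
      · dsimp only; split_ifs <;> positivity
      · dsimp only; split_ifs
        · exact le_max_left _ _
        · exact le_max_right _ _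
    have inum : IntervalIntegrable (numG n cn p (Icc 0 1) (shortcut γ a b) (prim fun _ => 1))
        volume 0 1 := by
      refine intervalIntegrable_congr_Ioo ?_
        (((hs (1 - p)).intervalIntegrable 0 1).mul_continuousOn hcσ)
      filter_upwards [haeσ, derivWithin_prim_ae h1] with t h2 h3 ht
      rw [numG, h3 (Ioo_subset_Icc_self ht), abs_one, Real.one_rpow, one_mul, mul_comm]
      rcases h2 ht with ⟨htI, hs⟩ | ⟨htI, hs, -⟩
      · rw [show gSpeedOn (Icc 0 1) (shortcut γ a b) t = r from hs, if_pos htI]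
      · rw [show gSpeedOn (Icc 0 1) (shortcut γ a b) t = L from hs, if_neg htI]
    have jden : IntervalIntegrable (fun t => (if t ∈ Ioo a b then r ^ (1:ℝ) else L ^ (1:ℝ))
        * (prim (fun _ => 1) t ^ p * Fvol n cn (shortcut γ a b t))) volume 0 1 :=
      ((hs 1).intervalIntegrable 0 1).mul_continuousOn
        ((h1.continuous_prim.continuousOn.rpow_const fun _ _ => Or.inr hp0).mul hcσ)
    have aden : ∀ᵐ t ∂(volume : Measure ℝ), t ∈ Ioo (0:ℝ) 1 →
        denG n cn p (Icc 0 1) (shortcut γ a b) (prim fun _ => 1) t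
          = (if t ∈ Ioo a b then r ^ (1:ℝ) else L ^ (1:ℝ))
            * (prim (fun _ => 1) t ^ p * Fvol n cn (shortcut γ a b t)) := by
      filter_upwards [haeσ] with t h2 ht
      rw [denG, abs_of_nonneg (h1.prim_nonneg ht.1.le), mul_comm]
      rcases h2 ht with ⟨htI, hs⟩ | ⟨htI, hs, -⟩
      · rw [show gSpeedOn (Icc 0 1) (shortcut γ a b) t = r from hs, if_pos htI, Real.rpow_one]
      · rw [show gSpeedOn (Icc 0 1) (shortcut γ a b) t = L from hs, if_neg htI, Real.rpow_one]
    refine ⟨_, prim fun _ => 1, h1.exists_lipschitz.imp fun K hK => hK.lipschitzOnWith,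
      by simp [prim], inum, intervalIntegrable_congr_Ioo aden jden, ?_, rfl⟩
    rw [integral_congr_Ioo aden]
    refine intervalIntegral.intervalIntegral_pos_of_pos_on jden (fun t ht => ?_) zero_lt_one
    have e1 : prim (fun _ => (1:ℝ)) t = t := by simp [prim]
    have e2 := Fvol_pos (n := n) hcn (hσ.2.2.2 t ⟨ht.1.le, ht.2⟩)
    have e3 := ht.1
    rw [e1]
    split_ifs <;> positivity
  · rintro q ⟨w, hw, h0, inum, iden, hpos, rfl⟩
    exact hbound w hw h0 inum iden hpos

lemma exists_coord_lower_bound {γ : ℝ → ℝ × ℝ} {T : ℝ} (hT0 : 0 ≤ T)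
    (hc : ContinuousOn γ (Icc 0 T)) (hinterior : ∀ t ∈ Icc 0 T, γ t ∈ Pint) :
    ∃ m > 0, ∀ t ∈ Icc 0 T, m ≤ (γ t).1 ∧ m ≤ (γ t).2 := by
  have hmin : ContinuousOn (fun t => min (γ t).1 (γ t).2) (Icc 0 T) :=
    ContinuousOn.inf hc.fst hc.snd
  obtain ⟨s, hs, hle⟩ := isCompact_Icc.exists_isMinOn (nonempty_Icc.2 hT0) hmin
  exact ⟨_, lt_min (hinterior s hs).1 (hinterior s hs).2, fun t ht => le_min_iff.1 (hle ht)⟩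

lemma le_shortcut {γ : ℝ → ℝ × ℝ} {a b m t : ℝ} (ht : t ∈ Icc a b)
    (ha : m ≤ (γ a).1 ∧ m ≤ (γ a).2) (hb : m ≤ (γ b).1 ∧ m ≤ (γ b).2) :
    m ≤ (shortcut γ a b t).1 ∧ m ≤ (shortcut γ a b t).2 := by
  have hba : 0 ≤ b - a := sub_nonneg.2 (ht.1.trans ht.2)
  have hs0 : 0 ≤ (t - a) / (b - a) := div_nonneg (sub_nonneg.2 ht.1) hba
  have hs1 : (t - a) / (b - a) ≤ 1 := div_le_one_of_le₀ (by linarith [ht.2]) hba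
  rw [shortcut_fst ht, shortcut_snd ht]
  constructor <;> nlinarith [ha.1, ha.2, hb.1, hb.2]

/-- The points of a curve of constant speed `L` stay close to those of its chord. -/
lemma shortcut_sub_sq_le {γ : ℝ → ℝ × ℝ} {L a b t : ℝ}
    (hγ : ∃ K, LipschitzOnWith K γ (Icc 0 1)) (hL : 0 ≤ L)
    (hspeed : ∀ᵐ t ∂(volume : Measure ℝ), t ∈ Icc (0:ℝ) 1 → gSpeed γ t = L)
    (ha : 0 ≤ a) (hb : b ≤ 1) (ht : t ∈ Ioo a b) :
    ((shortcut γ a b t).1 - (γ t).1) ^ 2 + ((shortcut γ a b t).2 - (γ t).2) ^ 2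
      ≤ ((L * (b - a)) ^ 2 - (((γ b).1 - (γ a).1) ^ 2 + ((γ b).2 - (γ a).2) ^ 2)) / 4 := by
  have hba : 0 < b - a := by linarith [ht.1, ht.2]
  have hs0 : 0 ≤ (t - a) / (b - a) := div_nonneg (by linarith [ht.1]) hba.le
  have hs1 : (t - a) / (b - a) ≤ 1 := by rw [div_le_one hba]; linarith [ht.2]
  have e : (t - a) / (b - a) * (b - a) = t - a := div_mul_cancel₀ _ hba.ne'
  have h₁ := chord_sq_le hγ hL hspeed ha ht.1.le (ht.2.le.trans hb)
  have h₂ := chord_sq_le hγ hL hspeed (ha.trans ht.1.le) ht.2.le hb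
  have h₃ := chord_sq_le hγ hL hspeed ha (ht.1.trans ht.2).le hb
  have key := dist_segment_sq_le hs0 hs1 (l := L * (b - a))
    (x := (γ t).1) (y := (γ t).2) (x₁ := (γ a).1) (y₁ := (γ a).2) (x₂ := (γ b).1) (y₂ := (γ b).2)
    (by rwa [show (t - a) / (b - a) * (L * (b - a)) = L * (t - a) by linear_combination L * e])
    (by rwa [show (1 - (t - a) / (b - a)) * (L * (b - a)) = L * (b - t) by
          linear_combination (-L) * e])
    le_rfl
  have hI := Ioo_subset_Icc_self ht
  rw [shortcut_fst hI, shortcut_snd hI]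
  set s := (t - a) / (b - a)
  have hs : s * (1 - s) ≤ 1 / 4 := by nlinarith [sq_nonneg (s - 1 / 2)]
  nlinarith [mul_le_mul_of_nonneg_right hs (sub_nonneg.2 h₃)]

/-- A maximizer has almost straight short arcs. -/
lemma chord_sq_ge_of_isMax {n : ℕ} {cn p x0 y0 L c T m a b : ℝ} {α : ℝ → ℝ × ℝ}
    (hn : 2 ≤ n) (hcn : 0 < cn) (hp : 2 * (n : ℝ) - 1 ≤ p) (hL : 0 < L)
    (h : MemRg x0 y0 α) (hinj : InjOn α (Icc 0 1))
    (hspeed : ∀ᵐ t ∂(volume : Measure ℝ), t ∈ Icc (0:ℝ) 1 → gSpeed α t = L)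
    (hc : 0 < c) (hv : ∀ t ∈ Icc (0:ℝ) 1, c * (1 - t) ≤ vcoord (α t))
    (hmax : ∀ γ : ℝ → ℝ × ℝ, MemRg x0 y0 γ → lambdaG n cn p γ ≤ lambdaG n cn p α)
    (hT : T < 1) (hm : 0 < m) (hα : ∀ t ∈ Icc 0 T, m ≤ (α t).1 ∧ m ≤ (α t).2)
    (ha : 0 ≤ a) (hab : a < b) (hb : b ≤ T) :
    (L * (b - a)) ^ 2 - ((2 * (n - 1) : ℕ) / m) ^ 2 * L ^ 4 * (b - a) ^ 4
      ≤ ((α b).1 - (α a).1) ^ 2 + ((α b).2 - (α a).2) ^ 2 := by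
  by_contra! hlt
  have hb1 : b < 1 := hb.trans_lt hT
  have hba : 0 < b - a := sub_pos.2 hab
  set q := ((α b).1 - (α a).1) ^ 2 + ((α b).2 - (α a).2) ^ 2 with hq
  have hq0 : 0 ≤ q := by positivity
  have hqpos : 0 < q := by
    refine hq0.lt_of_ne fun h0 => hab.ne' ?_
    refine hinj ⟨ha.trans hab.le, hb1.le⟩ ⟨ha, hab.le.trans hb1.le⟩ (Prod.ext ?_ ?_) <;>
      nlinarith [sq_nonneg ((α b).1 - (α a).1), sq_nonneg ((α b).2 - (α a).2)]
  set d := Real.sqrt q with hd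
  have hd0 : 0 < d := Real.sqrt_pos.2 hqpos
  have hdq : d ^ 2 = q := Real.sq_sqrt hq0
  set l := L * (b - a) with hl
  have hl0 : 0 < l := mul_pos hL hba
  have hql : q ≤ l ^ 2 := chord_sq_le h.1 hL.le hspeed ha hab.le hb1.le
  have hdl : d ≤ l := Real.sqrt_le_iff.2 ⟨hl0.le, hql⟩
  set N := 2 * (n - 1)
  have hD := distortion_lt_ratio (N := N) hm hd0 hdl (by rw [hdq, hl]; rw [hl] at hlt; linarith)
  set e := Real.sqrt (l ^ 2 - d ^ 2) / 2 with he
  have he0 : 0 ≤ e := by positivity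
  have he2 : e ^ 2 = (l ^ 2 - q) / 4 := by
    rw [he, div_pow, Real.sq_sqrt (by rw [hdq]; linarith), hdq]; norm_num
  set D := (1 + e / m) ^ N with hDdef
  have hD1 : 1 ≤ D := one_le_pow₀ (by linarith [div_nonneg he0 hm.le])
  have hr : 0 < d / (b - a) := div_pos hd0 hba
  have hdiv : L = l / d * (d / (b - a)) := by rw [hl]; field_simp
  have hld : 1 ≤ l / d := hD1.trans hD.le
  have hp1 : 1 ≤ p - 1 := by
    have : (2:ℝ) ≤ n := by exact_mod_cast hn
    linarith
  have hpow : D < (l / d) ^ (p - 1) := hD.trans_le (Real.self_le_rpow_of_one_le hld hp1)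
  have hrpow : (d / (b - a)) ^ (1 - p) = (l / d) ^ (p - 1) * L ^ (1 - p) := by
    have hx : (l / d) ^ (p - 1) * (l / d) ^ (1 - p) = 1 := by
      rw [← Real.rpow_add (by positivity)]; simp
    rw [hdiv, Real.mul_rpow (by positivity) hr.le, ← mul_assoc, hx, one_mul]
  have hF : ∀ t ∈ Ioo a b, Fvol n cn (shortcut α a b t) ≤ D * Fvol n cn (α t) ∧
      Fvol n cn (α t) ≤ D * Fvol n cn (shortcut α a b t) := by
    intro t ht
    have hI := Ioo_subset_Icc_self ht
    have b1 := hα t ⟨ha.trans hI.1, hI.2.trans hb⟩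
    have b2 := le_shortcut hI (hα a ⟨ha, hab.le.trans hb⟩) (hα b ⟨ha.trans hab.le, hb⟩)
    have hdist := shortcut_sub_sq_le h.1 hL.le hspeed ha hb1.le ht
    rw [← hl, ← hq, ← he2] at hdist
    refine ⟨Fvol_le_mul hcn hm b1.1 b1.2 b2.1 b2.2 hdist he0,
      Fvol_le_mul hcn hm b2.1 b2.2 b1.1 b1.2 ?_ he0⟩
    rwa [sub_sq_comm, sub_sq_comm (α t).2]
  have hFpos : ∀ t ∈ Ioo a b, 0 < Fvol n cn (α t) := fun t ht =>
    Fvol_pos hcn (h.2.2.2 t ⟨ha.trans ht.1.le, ht.2.trans hb1⟩)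
  have hD0 : 0 < D := zero_lt_one.trans_le hD1
  refine (hmax _ (shortcut_memRg ha hab hb1 h)).not_gt
    (lambdaG_lt_shortcut (r := d / (b - a)) (k := (l / d) ^ (p - 1) / D - 1) hn hcn hp hL h hspeed
      hc hv ha hab hb1 hr (sub_pos.2 ((one_lt_div hD0).2 hpow))
      (fun t ht => shortcut_speed_mem ha hb1.le ht) (fun t ht => ?_) fun t ht => ?_)
  · have h2 := (hF t ht).2
    rw [hrpow, add_sub_cancel]
    have hX : 0 ≤ (l / d) ^ (p - 1) * L ^ (1 - p) := by positivity
    calc (l / d) ^ (p - 1) / D * (Fvol n cn (α t) * L ^ (1 - p))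
        = (l / d) ^ (p - 1) * L ^ (1 - p) * (Fvol n cn (α t) / D) := by ring
      _ ≤ (l / d) ^ (p - 1) * L ^ (1 - p) * Fvol n cn (shortcut α a b t) := by
          gcongr; rwa [div_le_iff₀' hD0]
      _ = _ := by ring
  · calc Fvol n cn (shortcut α a b t) * (d / (b - a))
        ≤ D * Fvol n cn (α t) * (d / (b - a)) := by gcongr; exact (hF t ht).1
      _ ≤ l / d * Fvol n cn (α t) * (d / (b - a)) := by
          have := hFpos t ht
          gcongr
      _ = Fvol n cn (α t) * L := by rw [hdiv]; ring

lemma Lg_nonneg (α : ℝ → ℝ × ℝ) : 0 ≤ Lg α :=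
  intervalIntegral.integral_nonneg zero_le_one fun _ _ => Real.sqrt_nonneg _

lemma Lg_pos {x0 y0 : ℝ} {α : ℝ → ℝ × ℝ} (h : MemRg x0 y0 α)
    (hspeed : ∀ᵐ t ∂(volume : Measure ℝ), t ∈ Icc (0:ℝ) 1 → gSpeed α t = Lg α) : 0 < Lg α := by
  refine (Lg_nonneg α).lt_of_ne fun h0 => ?_
  have hch := chord_sq_le h.1 (Lg_nonneg α) hspeed le_rfl zero_le_one le_rfl
  rw [← h0] at hch
  obtain ⟨px, py⟩ := h.2.2.2 0 ⟨le_rfl, zero_lt_one⟩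
  rcases h.2.2.1.2 with hx | hx
  · rw [hx] at hch
    nlinarith [sq_nonneg ((α 1).2 - (α 0).2), mul_pos px px]
  · rw [hx] at hch
    nlinarith [sq_nonneg ((α 1).1 - (α 0).1), mul_pos py py]

/-- (Differentiability of maximizers.) Let `α ∈ R_g^*`
maximize `λ_{1,p}` over `R_g` (`p ≥ 2n-1`). Then `α` is differentiable at every
`t ∈ [0,1)` and `|α'(t)|_g = L_g(α)` for every `t ∈ [0,1)`. -/
theorem simons_stmt17 (n : ℕ) (hn : 2 ≤ n) (cn : ℝ) (hcn : 0 < cn)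
    (x0 y0 : ℝ) (hy0 : 0 < y0) (hxy : y0 ≤ x0)
    (p : ℝ) (hp : 2 * (n : ℝ) - 1 ≤ p)
    (α : ℝ → ℝ × ℝ) (hα : MemRgStar x0 y0 α)
    (hmax : ∀ γ : ℝ → ℝ × ℝ, MemRg x0 y0 γ → lambdaG n cn p γ ≤ lambdaG n cn p α) :
    (∀ t ∈ Ico (0:ℝ) 1, DifferentiableWithinAt ℝ α (Icc 0 1) t) ∧
    ∀ t ∈ Ico (0:ℝ) 1, gSpeed α t = Lg α := by
  obtain ⟨h, hinj, hspeed, -, c, hc, hv⟩ := hα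
  have hL := Lg_pos h hspeed
  rw [← forall₂_and]
  intro t ht
  obtain ⟨T, htT, hT⟩ := exists_between ht.2
  have hT0 : 0 ≤ T := ht.1.trans htT.le
  obtain ⟨m, hm, hcoord⟩ := exists_coord_lower_bound hT0
    (h.1.choose_spec.continuousOn.mono (Icc_subset_Icc_right hT.le))
    fun s hs => h.2.2.2 s ⟨hs.1, hs.2.trans_lt hT⟩
  exact differentiable_of_chord_sq_ge (K := ((2 * (n - 1) : ℕ) / m) ^ 2 * Lg α ^ 4) hL.le
    (by positivity) hT ht.1 htT
    (fun s u hs hsu hu => chord_sq_le h.1 hL.le hspeed hs hsu (hu.trans hT.le))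
    fun s u hs hsu hu => chord_sq_ge_of_isMax hn hcn hp hL h hinj hspeed hc hv hmax hT hm hcoord
      hs hsu hu
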